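/- For every even n ≥ 4516, the Ramsey number R(K_{2,n}, C_n) equals 2n−1. -/

import Mathlib

open SimpleGraph

/-- `G` contains `H` as a (not necessarily induced) subgraph. -/
def Contains {V W : Type*} (G : SimpleGraph V) (H : SimpleGraph W) : Prop :=
  ∃ f : H →g G, Function.Injective f

/-- `G` has a cycle with `m` vertices (equivalently, of length `m`). -/
def HasCycleLength {V : Type*} (G : SimpleGraph V) (m : ℕ) : Prop :=
  ∃ (v : V) (c : G.Walk v v), c.IsCycle ∧ c.length = m

/-- The Ramsey property for `K_{a,b}` versus the cycle `C_m`: every graph `Γ` on `N` vertices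
contains `K_{a,b}`, or its complement contains a cycle of length `m`. -/
def RamseyProp (a b m N : ℕ) : Prop :=
  ∀ Γ : SimpleGraph (Fin N),
    Contains Γ (completeBipartiteGraph (Fin a) (Fin b)) ∨ HasCycleLength Γᶜ m

/-- `G` is `k`-connected. -/
def IsKConnected {V : Type*} [Fintype V] (k : ℕ) (G : SimpleGraph V) : Prop :=
  k < Fintype.card V ∧
    ∀ S : Finset V, S.card < k → (G.induce ((↑S : Set V)ᶜ)).Connected

/-- The circumference of `G`: the length of a longest cycle. -/
noncomputable def circumference {V : Type*} (G : SimpleGraph V) : ℕ :=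
  sSup {m | HasCycleLength G m}

namespace RamseyCycle

variable {V : Type*}

/-- The first `p` values of `f` form a path of `G`. -/
structure PathOn (G : SimpleGraph V) (p : ℕ) (f : ℕ → V) : Prop where
  inj : ∀ i < p, ∀ j < p, f i = f j → i = j
  adj : ∀ i, i + 1 < p → G.Adj (f i) (f (i + 1))

/-- The first `p` values of `f` form, in cyclic order, a cycle of `G`. -/
structure CycleOn (G : SimpleGraph V) (p : ℕ) (f : ℕ → V) : Prop extends PathOn G p f where
  closed : G.Adj (f (p - 1)) (f 0)

lemma PathOn.mono_graph {G E : SimpleGraph V} (h : G ≤ E) {p : ℕ} {f : ℕ → V}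
    (hf : PathOn G p f) : PathOn E p f :=
  ⟨hf.inj, fun i hi => h (hf.adj i hi)⟩

lemma PathOn.take {G : SimpleGraph V} {p q : ℕ} {f : ℕ → V} (hf : PathOn G p f) (h : q ≤ p) :
    PathOn G q f :=
  ⟨fun i hi j hj => hf.inj i (by omega) j (by omega), fun i hi => hf.adj i (by omega)⟩

lemma PathOn.drop {G : SimpleGraph V} {p : ℕ} {f : ℕ → V} (hf : PathOn G p f) (k q : ℕ)
    (h : k + q ≤ p) : PathOn G q (fun i => f (k + i)) :=
  ⟨fun i hi j hj e => by have := hf.inj _ (by omega) _ (by omega) e; omega,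
    fun i hi => hf.adj (k + i) (by omega)⟩

lemma PathOn.reverse {G : SimpleGraph V} {p : ℕ} {f : ℕ → V} (hf : PathOn G p f) :
    PathOn G p (fun i => f (p - 1 - i)) := by
  refine ⟨fun i hi j hj e => ?_, fun i hi => ?_⟩
  · have := hf.inj _ (by omega) _ (by omega) e
    omega
  · have := hf.adj (p - 1 - (i + 1)) (by omega)
    rw [show p - 1 - (i + 1) + 1 = p - 1 - i by omega] at this
    exact this.symm

/-- Rotation of a path at its first vertex. -/
def rotateFirst (f : ℕ → V) (k : ℕ) : ℕ → V := fun i => if i < k then f (k - 1 - i) else f i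

lemma PathOn.rotateFirst {G : SimpleGraph V} {p k : ℕ} {f : ℕ → V} (hf : PathOn G p f)
    (hkp : k < p) (h : G.Adj (f 0) (f k)) : PathOn G p (rotateFirst f k) := by
  refine ⟨fun i hi j hj e => ?_, fun i hi => ?_⟩
  · unfold RamseyCycle.rotateFirst at e
    split_ifs at e <;> have := hf.inj _ (by omega) _ (by omega) e <;> omega
  · unfold RamseyCycle.rotateFirst
    split_ifs with h1 h2 h2
    · have := hf.adj (k - 1 - (i + 1)) (by omega)
      rw [show k - 1 - (i + 1) + 1 = k - 1 - i by omega] at this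
      exact this.symm
    · have e1 : k - 1 - i = 0 := by omega
      have e2 : i + 1 = k := by omega
      rw [e1, e2]; exact h
    · omega
    · exact hf.adj i hi

/-- Rotation of a path with `p` vertices at its last vertex. -/
def rotateLast (f : ℕ → V) (p k : ℕ) : ℕ → V := fun i => if i < k then f i else f (p - 1 - (i - k))

lemma PathOn.rotateLast {G : SimpleGraph V} {p k : ℕ} {f : ℕ → V} (hf : PathOn G p f)
    (hk : 0 < k) (hkp : k < p) (h : G.Adj (f (k - 1)) (f (p - 1))) :
    PathOn G p (rotateLast f p k) := by
  refine ⟨fun i hi j hj e => ?_, fun i hi => ?_⟩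
  · unfold RamseyCycle.rotateLast at e
    split_ifs at e <;> have := hf.inj _ (by omega) _ (by omega) e <;> omega
  · unfold RamseyCycle.rotateLast
    split_ifs with h1 h2 h2
    · exact hf.adj i hi
    · have e1 : k - 1 = i := by omega
      have e2 : p - 1 - (i + 1 - k) = p - 1 := by omega
      rw [e2, ← e1]; exact h
    · omega
    · have := hf.adj (p - 1 - (i + 1 - k)) (by omega)
      rw [show p - 1 - (i + 1 - k) + 1 = p - 1 - (i - k) by omega] at this
      exact this.symm

lemma PathOn.cycleOn_of_crossing {G : SimpleGraph V} {p k : ℕ} {f : ℕ → V} (hf : PathOn G p f)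
    (hk : 0 < k) (hkp : k < p) (h : G.Adj (f 0) (f k)) (h' : G.Adj (f (k - 1)) (f (p - 1))) :
    CycleOn G p (RamseyCycle.rotateFirst f k) := by
  refine ⟨hf.rotateFirst hkp h, ?_⟩
  unfold RamseyCycle.rotateFirst
  rw [if_neg (by omega), if_pos hk]
  simpa using h'.symm

lemma CycleOn.shift {G : SimpleGraph V} {p : ℕ} {f : ℕ → V} (hf : CycleOn G p f) (k : ℕ)
    (hk : k < p) :
    CycleOn G p (fun i => if i + k < p then f (i + k) else f (i + k - p)) := by
  refine ⟨⟨fun i hi j hj e => ?_, fun i hi => ?_⟩, ?_⟩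
  · split_ifs at e <;> have := hf.inj _ (by omega) _ (by omega) e <;> omega
  · split_ifs with h1 h2 h2
    · have := hf.adj (i + k) (by omega)
      rwa [show i + k + 1 = i + 1 + k by omega] at this
    · have := hf.closed
      rwa [show p - 1 = i + k by omega, show 0 = i + 1 + k - p by omega] at this
    · omega
    · have := hf.adj (i + k - p) (by omega)
      rwa [show i + k - p + 1 = i + 1 + k - p by omega] at this
  · rw [if_pos (show 0 + k < p by omega)]
    split_ifs with h1
    · have h0 : k = 0 := by omega
      subst h0; simpa using hf.closed
    · have := hf.adj (k - 1) (by omega)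
      rwa [show k - 1 + 1 = 0 + k by omega, show k - 1 = p - 1 + k - p by omega] at this

lemma PathOn.exists_walk {G : SimpleGraph V} {f : ℕ → V} (p : ℕ) (hf : PathOn G (p + 1) f) :
    ∃ w : G.Walk (f p) (f 0), w.IsPath ∧ w.length = p ∧ ∀ x ∈ w.support, ∃ i ≤ p, x = f i := by
  induction p with
  | zero => exact ⟨Walk.nil, by simp, rfl, by simp⟩
  | succ p ih =>
    obtain ⟨w, h1, h2, h3⟩ := ih (hf.take (by omega))
    refine ⟨Walk.cons (hf.adj p (by omega)).symm w, ?_, by simp [h2], ?_⟩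
    · rw [Walk.cons_isPath_iff]
      refine ⟨h1, fun hm => ?_⟩
      obtain ⟨i, hi, e⟩ := h3 _ hm
      have := hf.inj _ (by omega) _ (by omega) e
      omega
    · intro x hx
      rw [Walk.support_cons, List.mem_cons] at hx
      rcases hx with rfl | hx
      · exact ⟨p + 1, le_rfl, rfl⟩
      · obtain ⟨i, hi, e⟩ := h3 _ hx
        exact ⟨i, by omega, e⟩

lemma CycleOn.hasCycleLength {G : SimpleGraph V} {p : ℕ} {f : ℕ → V} (hf : CycleOn G p f)
    (hp : 3 ≤ p) : HasCycleLength G p := by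
  obtain ⟨q, rfl⟩ : ∃ q, p = q + 1 := ⟨p - 1, by omega⟩
  obtain ⟨w, h1, h2, -⟩ := hf.toPathOn.exists_walk q
  have hc : G.Adj (f 0) (f q) := by simpa using hf.closed.symm
  refine ⟨f 0, Walk.cons hc w, ?_, by simp [h2]⟩
  rw [Walk.cons_isCycle_iff]
  refine ⟨h1, fun hm => ?_⟩
  have := h1.length_eq_one_of_mem_edges (by rwa [Sym2.eq_swap] at hm)
  omega

open scoped Classical
open Finset

/-- The number of neighbours of `v` inside `K`. -/
noncomputable def degIn (G : SimpleGraph V) (K : Finset V) (v : V) : ℕ := #{w ∈ K | G.Adj v w}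

lemma degIn_mono_graph {G E : SimpleGraph V} (h : G ≤ E) (K : Finset V) (v : V) :
    degIn G K v ≤ degIn E K v :=
  card_le_card fun w hw => by
    simp only [mem_filter] at hw ⊢
    exact ⟨hw.1, h hw.2⟩

lemma degIn_mono (G : SimpleGraph V) {K L : Finset V} (h : K ⊆ L) (v : V) :
    degIn G K v ≤ degIn G L v :=
  card_le_card (filter_subset_filter _ h)

lemma degIn_le_card (G : SimpleGraph V) (K : Finset V) (v : V) : degIn G K v ≤ #K :=
  card_filter_le _ _

lemma degIn_union_le (G : SimpleGraph V) (K L : Finset V) (v : V) :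
    degIn G (K ∪ L) v ≤ degIn G K v + degIn G L v := by
  unfold degIn
  rw [filter_union]
  exact card_union_le _ _

lemma degIn_le_sdiff_add (G : SimpleGraph V) (K L : Finset V) (v : V) :
    degIn G K v ≤ degIn G (K \ L) v + #L := by
  have h1 : degIn G K v ≤ degIn G ((K \ L) ∪ L) v := degIn_mono G (by simp) v
  have h2 := degIn_union_le G (K \ L) L v
  have h3 := degIn_le_card G L v
  omega

lemma degIn_eq_card_range {G : SimpleGraph V} {K : Finset V} {f : ℕ → V}
    (hinj : ∀ i < #K, ∀ j < #K, f i = f j → i = j) (hK : ∀ i < #K, f i ∈ K) (v : V) :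
    degIn G K v = #{i ∈ range #K | G.Adj v (f i)} := by
  have himg : (range #K).image f = K := by
    apply eq_of_subset_of_card_le
    · intro x hx
      obtain ⟨i, hi, rfl⟩ := mem_image.1 hx
      exact hK i (mem_range.1 hi)
    · rw [card_image_of_injOn, card_range]
      intro i hi j hj e
      exact hinj i (by simpa using hi) j (by simpa using hj) e
  unfold degIn
  conv_lhs => rw [← himg]
  rw [filter_image, card_image_of_injOn]
  intro i hi j hj e
  simp only [coe_filter, mem_range, Set.mem_ofPred_eq] at hi hj
  exact hinj i hi.1 j hj.1 e

/-- `G` has a cycle through exactly the vertices of `K`. -/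
def Spans (G : SimpleGraph V) (K : Finset V) : Prop :=
  ∃ f : ℕ → V, CycleOn G #K f ∧ ∀ i < #K, f i ∈ K

lemma CycleOn.mono_graph {G E : SimpleGraph V} (h : G ≤ E) {p : ℕ} {f : ℕ → V}
    (hf : CycleOn G p f) : CycleOn E p f :=
  ⟨hf.toPathOn.mono_graph h, h hf.closed⟩

lemma Spans.mono_graph {G E : SimpleGraph V} (h : G ≤ E) {K : Finset V} (hs : Spans G K) :
    Spans E K :=
  let ⟨f, h1, h2⟩ := hs
  ⟨f, h1.mono_graph h, h2⟩

lemma Spans.hasCycleLength {G : SimpleGraph V} {K : Finset V} (hs : Spans G K) (h : 3 ≤ #K) :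
    HasCycleLength G #K :=
  let ⟨_, h1, _⟩ := hs
  h1.hasCycleLength h

lemma PathOn.exists_crossing {G : SimpleGraph V} {p : ℕ} {f : ℕ → V} (S : Finset ℕ)
    (hI : ∀ i < p, G.Adj (f 0) (f i) → i ∈ S)
    (hJ : ∀ i, i + 1 < p → G.Adj (f (p - 1)) (f i) → i + 1 ∈ S)
    (hc : #S < #{i ∈ range p | G.Adj (f 0) (f i)} + #{i ∈ range p | G.Adj (f (p - 1)) (f i)}) :
    ∃ k, 0 < k ∧ k < p ∧ G.Adj (f 0) (f k) ∧ G.Adj (f (k - 1)) (f (p - 1)) := by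
  by_contra! hno
  have h1 : #({i ∈ range p | G.Adj (f 0) (f i)} ∪
      ({i ∈ range p | G.Adj (f (p - 1)) (f i)}).image (· + 1)) ≤ #S := by
    apply card_le_card
    intro x hx
    simp only [mem_union, mem_filter, mem_range, mem_image] at hx
    rcases hx with ⟨h1, h2⟩ | ⟨i, ⟨h1, h2⟩, rfl⟩
    · exact hI x h1 h2
    · refine hJ i ?_ h2
      by_contra hlt
      rw [show i = p - 1 by omega] at h2
      exact G.irrefl h2
  rw [card_union_of_disjoint, card_image_of_injective _ (add_left_injective 1)] at h1
  · omega
  · rw [Finset.disjoint_left]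
    intro x hx hx'
    simp only [mem_filter, mem_range, mem_image] at hx hx'
    obtain ⟨i, ⟨h2, h3⟩, rfl⟩ := hx'
    exact hno (i + 1) (by omega) hx.1 hx.2 (by simpa using h3.symm)

lemma Spans.of_edge {E : SimpleGraph V} {K : Finset V} {u v : V} (hK : 3 ≤ #K)
    (hs : Spans (E ⊔ edge u v) K) :
    Spans E K ∨ ∃ f, PathOn E #K f ∧ (∀ i < #K, f i ∈ K) ∧ f 0 = u ∧ f (#K - 1) = v := by
  obtain ⟨f, hf, hfK⟩ := hs
  have key : ∀ a b, (E ⊔ edge u v).Adj a b → ¬ E.Adj a b → (a = u ∧ b = v) ∨ (a = v ∧ b = u) := by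
    intro a b h1 h2
    rw [sup_adj, edge_adj] at h1
    tauto
  have main : ∀ g, CycleOn (E ⊔ edge u v) #K g → (∀ i < #K, g i ∈ K) →
      ¬ E.Adj (g (#K - 1)) (g 0) →
      ∃ f, PathOn E #K f ∧ (∀ i < #K, f i ∈ K) ∧ f 0 = u ∧ f (#K - 1) = v := by
    intro g hg hgK hn
    have hp : PathOn E #K g := by
      refine ⟨hg.inj, fun i hi => ?_⟩
      by_contra hE
      have h1 := key _ _ (hg.adj i hi) hE
      have h2 := key _ _ hg.closed hn
      have inj : ∀ a b, a < #K → b < #K → g a = g b → a = b := fun a b ha hb => hg.inj a ha b hb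
      rcases h1 with ⟨h1, h1'⟩ | ⟨h1, h1'⟩ <;> rcases h2 with ⟨h2, h2'⟩ | ⟨h2, h2'⟩
      · have := inj i (#K - 1) (by omega) (by omega) (h1.trans h2.symm); omega
      · have := inj i 0 (by omega) (by omega) (h1.trans h2'.symm)
        have := inj (i + 1) (#K - 1) (by omega) (by omega) (h1'.trans h2.symm); omega
      · have := inj i 0 (by omega) (by omega) (h1.trans h2'.symm)
        have := inj (i + 1) (#K - 1) (by omega) (by omega) (h1'.trans h2.symm); omega
      · have := inj i (#K - 1) (by omega) (by omega) (h1.trans h2.symm); omega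
    rcases key _ _ hg.closed hn with ⟨h1, h2⟩ | ⟨h1, h2⟩
    · refine ⟨_, hp.reverse, fun i hi => hgK _ (by omega), ?_, ?_⟩
      · simpa using h1
      · simpa using h2
    · exact ⟨g, hp, hgK, h2, h1⟩
  by_cases h0 : E.Adj (f (#K - 1)) (f 0)
  · by_cases hall : ∀ i, i + 1 < #K → E.Adj (f i) (f (i + 1))
    · exact Or.inl ⟨f, ⟨⟨hf.inj, hall⟩, h0⟩, hfK⟩
    · push Not at hall
      obtain ⟨i, hi, hn⟩ := hall
      right
      refine main _ (hf.shift (i + 1) hi) (fun j hj => ?_) ?_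
      · split_ifs
        · exact hfK _ (by assumption)
        · exact hfK _ (by omega)
      · rw [if_neg (by omega), if_pos (by omega)]
        rwa [show #K - 1 + (i + 1) - #K = i by omega, zero_add]
  · exact Or.inr (main f hf hfK h0)

lemma exists_maximal_not_spans [Finite V] {G T : SimpleGraph V} (hGT : G ≤ T) {K : Finset V}
    (hG : ¬ Spans G K) :
    ∃ E, G ≤ E ∧ E ≤ T ∧ ¬ Spans E K ∧
      ∀ u v, T.Adj u v → ¬ E.Adj u v → Spans (E ⊔ edge u v) K := by
  obtain ⟨E, hGE, hE⟩ := (Set.toFinite {E : SimpleGraph V | E ≤ T ∧ ¬ Spans E K}).exists_le_maximal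
    (show G ∈ _ from ⟨hGT, hG⟩)
  refine ⟨E, hGE, hE.prop.1, hE.prop.2, fun u v hT hn => ?_⟩
  by_contra hs
  have h1 : E ⊔ edge u v ≤ T := by
    refine sup_le hE.prop.1 fun a b hab => ?_
    rw [edge_adj] at hab
    rcases hab.1 with ⟨rfl, rfl⟩ | ⟨rfl, rfl⟩
    · exact hT
    · exact hT.symm
  have h2 := hE.le_of_ge (show E ⊔ edge u v ∈ _ from ⟨h1, hs⟩) le_sup_left
  refine hn (h2 ?_)
  rw [sup_adj, edge_adj]
  exact Or.inr ⟨Or.inl ⟨rfl, rfl⟩, hT.ne⟩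

lemma spans_of_clique {E : SimpleGraph V} {K : Finset V} (hK : 3 ≤ #K)
    (h : ∀ x ∈ K, ∀ y ∈ K, x ≠ y → E.Adj x y) : Spans E K := by
  obtain ⟨v0, -⟩ : K.Nonempty := card_pos.1 (by omega)
  let f : ℕ → V := fun i => if hi : i < #K then (K.equivFin.symm ⟨i, hi⟩ : V) else v0
  have hf : ∀ i (hi : i < #K), f i = K.equivFin.symm ⟨i, hi⟩ := fun i hi => dif_pos hi
  have hfK : ∀ i < #K, f i ∈ K := fun i hi => by rw [hf i hi]; exact Subtype.prop _
  have hinj : ∀ i < #K, ∀ j < #K, f i = f j → i = j := by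
    intro i hi j hj e
    rw [hf i hi, hf j hj] at e
    have := K.equivFin.symm.injective (Subtype.ext e)
    simpa using this
  refine ⟨f, ⟨⟨hinj, fun i hi => ?_⟩, ?_⟩, hfK⟩
  · refine h _ (hfK _ (by omega)) _ (hfK _ hi) fun e => ?_
    have := hinj _ (by omega) _ hi e
    omega
  · refine h _ (hfK _ (by omega)) _ (hfK _ (by omega)) fun e => ?_
    have := hinj _ (by omega) _ (by omega) e
    omega

lemma clique_grow {E : SimpleGraph V} {K C C' : Finset V}
    (hore : ∀ u ∈ K, ∀ v ∈ K, u ≠ v → #K ≤ degIn E K u + degIn E K v → E.Adj u v)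
    (hC : ∀ x ∈ C, ∀ y ∈ C, x ≠ y → E.Adj x y) (hCC : C ⊆ C') (hCK : C' ⊆ K)
    (hd : ∀ v ∈ C', v ∉ C → #K + 1 ≤ degIn E K v + #C) :
    ∀ x ∈ C', ∀ y ∈ C', x ≠ y → E.Adj x y := by
  have h1 : ∀ x ∈ C, #C ≤ degIn E K x + 1 := by
    intro x hx
    have : C.erase x ⊆ {w ∈ K | E.Adj x w} := by
      intro y hy
      rw [mem_erase] at hy
      rw [mem_filter]
      exact ⟨hCK (hCC hy.2), hC x hx y hy.2 hy.1.symm⟩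
    have := card_le_card this
    rw [card_erase_of_mem hx] at this
    unfold degIn
    omega
  have h2 : ∀ x ∈ C, ∀ y ∈ C', y ∉ C → E.Adj x y := by
    intro x hx y hy hyC
    refine hore x (hCK (hCC hx)) y (hCK hy) (fun e => hyC (e ▸ hx)) ?_
    have := h1 x hx
    have := hd y hy hyC
    omega
  have h3 : ∀ y ∈ C', y ∉ C → #C ≤ degIn E K y := by
    intro y hy hyC
    refine card_le_card fun x hx => ?_
    rw [mem_filter]
    exact ⟨hCK (hCC hx), (h2 x hx y hy hyC).symm⟩
  intro x hx y hy hxy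
  by_cases hxC : x ∈ C <;> by_cases hyC : y ∈ C
  · exact hC x hxC y hyC hxy
  · exact h2 x hxC y hy hyC
  · exact (h2 y hyC x hx hxC).symm
  · refine hore x (hCK hx) y (hCK hy) hxy ?_
    have := h3 x hx hxC
    have := hd y hy hyC
    omega

lemma exists_closure [Finite V] {G : SimpleGraph V} {K : Finset V} (hK : 3 ≤ #K)
    (hG : ¬ Spans G K) :
    ∃ E, G ≤ E ∧ ¬ Spans E K ∧
      ∀ u ∈ K, ∀ v ∈ K, u ≠ v → #K ≤ degIn E K u + degIn E K v → E.Adj u v := by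
  obtain ⟨E, hGE, -, hE, hmax⟩ := exists_maximal_not_spans (le_top : G ≤ ⊤) hG
  refine ⟨E, hGE, hE, ?_⟩
  intro u hu v hv huv hd
  by_contra hn
  rcases (hmax u v huv hn).of_edge hK with h | ⟨f, hf, hfK, rfl, rfl⟩
  · exact hE h
  · rw [degIn_eq_card_range hf.inj hfK, degIn_eq_card_range hf.inj hfK] at hd
    obtain ⟨k, hk, hkp, a1, a2⟩ := PathOn.exists_crossing (G := E) (p := #K) (f := f)
      (Finset.Ico 1 #K) (fun i hi ha => by
        rw [Finset.mem_Ico]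
        refine ⟨?_, hi⟩
        by_contra h0
        rw [show i = 0 by omega] at ha
        exact E.irrefl ha) (fun i hi _ => by rw [Finset.mem_Ico]; omega)
      (by rw [Nat.card_Ico]; omega)
    refine hE ⟨_, hf.cycleOn_of_crossing hk hkp a1 a2, fun i hi => ?_⟩
    unfold rotateFirst
    split_ifs
    · exact hfK _ (by omega)
    · exact hfK _ hi

lemma spans_of_growth [Finite V] {G : SimpleGraph V} {K C C' : Finset V} (hK : 3 ≤ #K)
    (hCC : C ⊆ C') (hCK : C' ⊆ K) (h0 : ∀ v ∈ C, #K ≤ 2 * degIn G K v)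
    (h1 : ∀ v ∈ C', v ∉ C → #K + 1 ≤ degIn G K v + #C)
    (h2 : ∀ v ∈ K, v ∉ C' → #K + 1 ≤ degIn G K v + #C') : Spans G K := by
  by_contra hG
  obtain ⟨E, hGE, hE, hore⟩ := exists_closure hK hG
  have hmono := fun v => degIn_mono_graph hGE K v
  have c0 : ∀ x ∈ C, ∀ y ∈ C, x ≠ y → E.Adj x y := by
    intro x hx y hy hxy
    refine hore x (hCK (hCC hx)) y (hCK (hCC hy)) hxy ?_
    have := h0 x hx
    have := h0 y hy
    have := hmono x
    have := hmono y
    omega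
  have c1 := clique_grow hore c0 hCC hCK fun v hv hvC => (h1 v hv hvC).trans
    (Nat.add_le_add_right (hmono v) _)
  have c2 := clique_grow hore c1 hCK Subset.rfl fun v hv hvC => (h2 v hv hvC).trans
    (Nat.add_le_add_right (hmono v) _)
  exact hE (spans_of_clique hK c2)

lemma spans_bipartite [Finite V] {G : SimpleGraph V} {P Q : Finset V} (hPQ : Disjoint P Q)
    (hk : #P = #Q) (hk2 : 2 ≤ #P) (hP : ∀ v ∈ P, #P + 1 ≤ 2 * degIn G Q v)
    (hQ : ∀ v ∈ Q, #P + 1 ≤ 2 * degIn G P v) : Spans G (P ∪ Q) := by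
  have hcard : #(P ∪ Q) = #P + #Q := card_union_of_disjoint hPQ
  have hdis : ∀ x, x ∈ P → x ∈ Q → False := fun x h1 h2 => Finset.disjoint_left.1 hPQ h1 h2
  let T : SimpleGraph V :=
    { Adj := fun a b => (a ∈ P ∧ b ∈ Q) ∨ (a ∈ Q ∧ b ∈ P)
      symm := ⟨fun a b h => by tauto⟩
      loopless := ⟨fun a h => by
        rcases h with h | h
        · exact hdis a h.1 h.2
        · exact hdis a h.2 h.1⟩ }
  have hT : ∀ a b, T.Adj a b ↔ (a ∈ P ∧ b ∈ Q) ∨ (a ∈ Q ∧ b ∈ P) := fun a b => Iff.rfl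
  by_contra hG
  have hG' : ¬ Spans (G ⊓ T) (P ∪ Q) := fun h => hG (h.mono_graph inf_le_left)
  obtain ⟨E, hGE, hET, hE, hmax⟩ := exists_maximal_not_spans (inf_le_right : G ⊓ T ≤ T) hG'
  have hdP : ∀ v ∈ P, degIn G Q v ≤ degIn E (P ∪ Q) v := fun v hv =>
    card_le_card fun w hw => by
      rw [mem_filter] at hw ⊢
      exact ⟨mem_union_right _ hw.1, hGE ⟨hw.2, Or.inl ⟨hv, hw.1⟩⟩⟩
  have hdQ : ∀ v ∈ Q, degIn G P v ≤ degIn E (P ∪ Q) v := fun v hv =>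
    card_le_card fun w hw => by
      rw [mem_filter] at hw ⊢
      exact ⟨mem_union_left _ hw.1, hGE ⟨hw.2, Or.inr ⟨hv, hw.1⟩⟩⟩
  have hcomp : ∀ u ∈ P, ∀ v ∈ Q, E.Adj u v := by
    intro u hu v hv
    by_contra hn
    rcases (hmax u v (Or.inl ⟨hu, hv⟩) hn).of_edge (by omega) with h | ⟨f, hf, hfK, rfl, rfl⟩
    · exact hE h
    · have hd1 := (hP _ hu).trans (Nat.mul_le_mul_left 2 (hdP _ hu))
      have hd2 := (hQ _ hv).trans (Nat.mul_le_mul_left 2 (hdQ _ hv))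
      rw [degIn_eq_card_range hf.inj hfK] at hd1 hd2
      have hS : #{i ∈ range #(P ∪ Q) | f i ∈ Q} ≤ #Q := by
        rw [← card_image_of_injOn (f := f)]
        · refine card_le_card fun x hx => ?_
          obtain ⟨i, hi, rfl⟩ := mem_image.1 hx
          exact (mem_filter.1 hi).2
        · intro i hi j hj e
          simp only [coe_filter, mem_range, Set.mem_ofPred_eq] at hi hj
          exact hf.inj i hi.1 j hj.1 e
      obtain ⟨k, hk, hkp, a1, a2⟩ := PathOn.exists_crossing (G := E) (p := #(P ∪ Q)) (f := f)
        {i ∈ range #(P ∪ Q) | f i ∈ Q} (fun i hi ha => by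
          rw [mem_filter, mem_range]
          refine ⟨hi, ?_⟩
          rcases hET ha with h | h
          · exact h.2
          · exact (hdis _ hu h.1).elim) (fun i hi ha => by
          rw [mem_filter, mem_range]
          refine ⟨hi, ?_⟩
          have hiP : f i ∈ P := by
            rcases hET ha with h | h
            · exact (hdis _ h.1 hv).elim
            · exact h.2
          rcases hET (hf.adj i hi) with h | h
          · exact h.2
          · exact (hdis _ hiP h.1).elim) (by omega)
      refine hE ⟨_, hf.cycleOn_of_crossing hk hkp a1 a2, fun i hi => ?_⟩
      unfold rotateFirst
      split_ifs
      · exact hfK _ (by omega)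
      · exact hfK _ hi
  obtain ⟨v0, -⟩ : P.Nonempty := card_pos.1 (by omega)
  let a : ℕ → V := fun i => if hi : i < #P then (P.equivFin.symm ⟨i, hi⟩ : V) else v0
  let b : ℕ → V := fun i => if hi : i < #Q then (Q.equivFin.symm ⟨i, hi⟩ : V) else v0
  have ha : ∀ i (hi : i < #P), a i = P.equivFin.symm ⟨i, hi⟩ := fun i hi => dif_pos hi
  have hb : ∀ i (hi : i < #Q), b i = Q.equivFin.symm ⟨i, hi⟩ := fun i hi => dif_pos hi
  have haP : ∀ i < #P, a i ∈ P := fun i hi => by rw [ha i hi]; exact Subtype.prop _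
  have hbQ : ∀ i < #Q, b i ∈ Q := fun i hi => by rw [hb i hi]; exact Subtype.prop _
  have ainj : ∀ i < #P, ∀ j < #P, a i = a j → i = j := by
    intro i hi j hj e
    rw [ha i hi, ha j hj] at e
    simpa using P.equivFin.symm.injective (Subtype.ext e)
  have binj : ∀ i < #Q, ∀ j < #Q, b i = b j → i = j := by
    intro i hi j hj e
    rw [hb i hi, hb j hj] at e
    simpa using Q.equivFin.symm.injective (Subtype.ext e)
  let f : ℕ → V := fun i => if i % 2 = 0 then a (i / 2) else b (i / 2)
  have hf0 : ∀ i, i % 2 = 0 → f i = a (i / 2) := fun i hi => if_pos hi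
  have hf1 : ∀ i, i % 2 = 1 → f i = b (i / 2) := fun i hi => if_neg (by omega)
  refine hE ⟨f, ⟨⟨fun i hi j hj e => ?_, fun i hi => ?_⟩, ?_⟩, fun i hi => ?_⟩
  · rcases Nat.mod_two_eq_zero_or_one i with h1 | h1 <;>
      rcases Nat.mod_two_eq_zero_or_one j with h2 | h2
    · rw [hf0 i h1, hf0 j h2] at e
      have := ainj _ (by omega) _ (by omega) e
      omega
    · rw [hf0 i h1, hf1 j h2] at e
      exact (hdis _ (haP _ (by omega)) (e ▸ hbQ (j / 2) (by omega))).elim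
    · rw [hf1 i h1, hf0 j h2] at e
      exact (hdis _ (haP _ (by omega)) (e ▸ hbQ (i / 2) (by omega))).elim
    · rw [hf1 i h1, hf1 j h2] at e
      have := binj _ (by omega) _ (by omega) e
      omega
  · rcases Nat.mod_two_eq_zero_or_one i with h1 | h1
    · rw [hf0 i h1, hf1 (i + 1) (by omega)]
      exact hcomp _ (haP _ (by omega)) _ (hbQ _ (by omega))
    · rw [hf1 i h1, hf0 (i + 1) (by omega)]
      exact (hcomp _ (haP _ (by omega)) _ (hbQ _ (by omega))).symm
  · rw [hf1 _ (by omega), hf0 0 rfl]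
    exact (hcomp _ (haP _ (by omega)) _ (hbQ _ (by omega))).symm
  · rcases Nat.mod_two_eq_zero_or_one i with h1 | h1
    · rw [hf0 i h1]; exact mem_union_left _ (haP _ (by omega))
    · rw [hf1 i h1]; exact mem_union_right _ (hbQ _ (by omega))

lemma sum_degIn_comm (G : SimpleGraph V) (A B : Finset V) :
    ∑ a ∈ A, degIn G B a = ∑ b ∈ B, degIn G A b := by
  simp only [degIn, card_filter]
  rw [sum_comm]
  simp only [G.adj_comm]

lemma sum_mult_eq {ι : Type*} (I : Finset ι) (T : ι → Finset V) (Ω : Finset V) :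
    ∑ w ∈ Ω, #{i ∈ I | w ∈ T i} = ∑ i ∈ I, #(Ω ∩ T i) := by
  simp only [card_filter, ← filter_mem_eq_inter]
  rw [sum_comm]

lemma sum_mult_sq_le {ι : Type*} (I : Finset ι) (T : ι → Finset V) (Ω : Finset V) (c : ℕ)
    (hpair : ∀ i ∈ I, ∀ j ∈ I, i ≠ j → #(Ω ∩ (T i ∩ T j)) ≤ c) :
    ∑ w ∈ Ω, #{i ∈ I | w ∈ T i} ^ 2 ≤
      c * (#I * (#I - 1)) + ∑ w ∈ Ω, #{i ∈ I | w ∈ T i} := by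
  have h1 : ∑ w ∈ Ω, #{i ∈ I | w ∈ T i} ^ 2 = ∑ i ∈ I, ∑ j ∈ I, #(Ω ∩ (T i ∩ T j)) := by
    have : ∀ w, #{i ∈ I | w ∈ T i} ^ 2 =
        ∑ i ∈ I, ∑ j ∈ I, if w ∈ T i ∩ T j then 1 else 0 := by
      intro w
      rw [sq, card_filter, sum_mul_sum]
      refine sum_congr rfl fun i _ => sum_congr rfl fun j _ => ?_
      by_cases h1 : w ∈ T i <;> by_cases h2 : w ∈ T j <;> simp [h1, h2]
    simp only [this]
    rw [sum_comm]
    refine sum_congr rfl fun i _ => ?_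
    rw [sum_comm]
    refine sum_congr rfl fun j _ => ?_
    rw [← filter_mem_eq_inter (s := Ω), card_filter]
  rw [h1, sum_mult_eq]
  have h2 : ∀ i ∈ I, ∑ j ∈ I, #(Ω ∩ (T i ∩ T j)) ≤ c * (#I - 1) + #(Ω ∩ T i) := by
    intro i hi
    rw [← sum_erase_add _ _ hi]
    refine Nat.add_le_add ?_ (by simp)
    rw [← card_erase_of_mem hi, mul_comm, ← smul_eq_mul]
    exact sum_le_card_nsmul _ _ _ fun j hj =>
      hpair i hi j (mem_of_mem_erase hj) (ne_of_mem_erase hj).symm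
  refine (sum_le_sum h2).trans (le_of_eq ?_)
  rw [sum_add_distrib, sum_const, smul_eq_mul]
  ring

lemma johnson_bound {ι : Type*} (I : Finset ι) (T : ι → Finset V) (Ω : Finset V) (c t : ℕ)
    (hpair : ∀ i ∈ I, ∀ j ∈ I, i ≠ j → #(Ω ∩ (T i ∩ T j)) ≤ c)
    (ht : ∀ i ∈ I, t ≤ #(Ω ∩ T i)) :
    #I * t * (#I * t) ≤ #Ω * (c * (#I * (#I - 1)) + #I * t) := by
  have h1 := sum_mult_sq_le I T Ω c hpair
  have h2 : #I * t ≤ ∑ w ∈ Ω, #{i ∈ I | w ∈ T i} := by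
    rw [sum_mult_eq, ← smul_eq_mul]
    exact card_nsmul_le_sum _ _ _ ht
  have h3 := sq_sum_le_card_mul_sum_sq (s := Ω) (f := fun w => #{i ∈ I | w ∈ T i})
  set S := ∑ w ∈ Ω, #{i ∈ I | w ∈ T i}
  have h4 : S ^ 2 ≤ #Ω * (c * (#I * (#I - 1)) + S) := h3.trans (Nat.mul_le_mul_left _ h1)
  generalize c * (#I * (#I - 1)) = A at *
  generalize #I * t = x at *
  generalize #Ω = M at *
  rcases le_total x M with h | h
  · nlinarith
  · zify at *
    nlinarith

lemma card_lt_of_johnson {ι : Type*} (B : Finset ι) (T : ι → Finset V) (Ω : Finset V)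
    (c t k M : ℕ) (hpair : ∀ i ∈ B, ∀ j ∈ B, i ≠ j → #(Ω ∩ (T i ∩ T j)) ≤ c)
    (ht : ∀ i ∈ B, t ≤ #(Ω ∩ T i)) (hM : #Ω ≤ M)
    (hnum : M * (c * (k * (k - 1)) + k * t) < k * t * (k * t)) : #B < k := by
  by_contra! h
  obtain ⟨I, hI, rfl⟩ := exists_subset_card_eq h
  have := johnson_bound I T Ω c t (fun i hi j hj => hpair i (hI hi) j (hI hj))
    (fun i hi => ht i (hI hi))
  have := Nat.mul_le_mul_right (c * (#I * (#I - 1)) + #I * t) hM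
  omega

lemma card_le_of_pair_miss {G : SimpleGraph V} {C D : Finset V} {κ θ y : ℕ}
    (hpair : ∀ a ∈ C, ∀ b ∈ C, a ≠ b → #{w ∈ D | ¬ G.Adj a w ∧ ¬ G.Adj b w} ≤ κ)
    (hd : ∀ d ∈ D, degIn G C d ≤ θ) (hnum : θ * #D < y * (#C - 1)) : #D ≤ κ + 2 * y := by
  have key : ∃ a ∈ C, ∃ b ∈ C, a ≠ b ∧ degIn G D a ≤ y ∧ degIn G D b ≤ y := by
    by_contra! hno
    have h1 : #{a ∈ C | degIn G D a ≤ y} ≤ 1 := by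
      rw [card_le_one]
      intro a ha b hb
      rw [mem_filter] at ha hb
      by_contra hab
      exact absurd hb.2 (not_le.2 (hno a ha.1 b hb.1 hab ha.2))
    have h2 : #C - 1 ≤ #{a ∈ C | ¬ degIn G D a ≤ y} := by
      have := card_filter_add_card_filter_not (s := C) (fun a => degIn G D a ≤ y)
      omega
    have h3 : (#C - 1) * y ≤ ∑ a ∈ C, degIn G D a := by
      refine (Nat.mul_le_mul_right y h2).trans ?_
      rw [← smul_eq_mul]
      refine (card_nsmul_le_sum _ (fun a => degIn G D a) y fun a ha => ?_).trans
        (sum_le_sum_of_subset (filter_subset _ _))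
      exact (not_le.1 (mem_filter.1 ha).2).le
    rw [sum_degIn_comm] at h3
    have h4 := sum_le_card_nsmul D (fun d => degIn G C d) θ hd
    rw [smul_eq_mul] at h4
    nlinarith
  obtain ⟨a, ha, b, hb, hab, h1, h2⟩ := key
  have h3 : D ⊆ {w ∈ D | G.Adj a w} ∪ {w ∈ D | G.Adj b w} ∪
      {w ∈ D | ¬ G.Adj a w ∧ ¬ G.Adj b w} := by
    intro w hw
    simp only [mem_union, mem_filter, hw, true_and]
    tauto
  have h4 := card_le_card h3
  have h5 := card_union_le ({w ∈ D | G.Adj a w} ∪ {w ∈ D | G.Adj b w})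
      {w ∈ D | ¬ G.Adj a w ∧ ¬ G.Adj b w}
  have h6 := card_union_le {w ∈ D | G.Adj a w} {w ∈ D | G.Adj b w}
  have h7 := hpair a ha b hb hab
  unfold degIn at h1 h2
  omega

lemma exists_distinct_representatives [Nonempty V] {ι : Type*} (D : Finset ι) (S : ι → Finset V)
    (X : Finset V) (h : ∀ i ∈ D, #X + #D ≤ #(S i)) :
    ∃ f : ι → V, (∀ i ∈ D, ∀ j ∈ D, f i = f j → i = j) ∧ ∀ i ∈ D, f i ∈ S i ∧ f i ∉ X := by
  induction D using Finset.induction_on with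
  | empty =>
    exact ⟨fun _ => Classical.arbitrary V, by simp, by simp⟩
  | insert a D ha ih =>
    rw [card_insert_of_notMem ha] at h
    obtain ⟨f, h1, h2⟩ := ih fun i hi => by
      have := h i (mem_insert_of_mem hi)
      omega
    have h3 : (S a \ (X ∪ D.image f)).Nonempty := by
      rw [← card_pos]
      have := le_card_sdiff (X ∪ D.image f) (S a)
      have := card_union_le X (D.image f)
      have := card_image_le (s := D) (f := f)
      have := h a (mem_insert_self a D)
      omega
    obtain ⟨x, hx⟩ := h3
    simp only [mem_sdiff, mem_union, mem_image, not_or, not_exists, not_and] at hx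
    refine ⟨Function.update f a x, ?_, ?_⟩
    · intro i hi j hj e
      rw [mem_insert] at hi hj
      by_cases hia : i = a <;> by_cases hja : j = a
      · rw [hia, hja]
      · subst hia
        rw [Function.update_self, Function.update_of_ne hja] at e
        exact (hx.2.2 j (hj.resolve_left hja) e.symm).elim
      · subst hja
        rw [Function.update_self, Function.update_of_ne hia] at e
        exact (hx.2.2 i (hi.resolve_left hia) e).elim
      · rw [Function.update_of_ne hia, Function.update_of_ne hja] at e
        exact h1 i (hi.resolve_left hia) j (hj.resolve_left hja) e
    · intro i hi
      rw [mem_insert] at hi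
      by_cases hia : i = a
      · subst hia
        rw [Function.update_self]
        exact ⟨hx.1, hx.2.1⟩
      · rw [Function.update_of_ne hia]
        exact h2 i (hi.resolve_left hia)

lemma exists_large_degIn {G : SimpleGraph V} {R Y : Finset V} (hY : Y.Nonempty) {a b : ℕ}
    (hR : ∀ r ∈ R, a * #Y ≤ b * degIn G Y r) : ∃ d ∈ Y, a * #R ≤ b * degIn G R d := by
  by_contra! hno
  have h1 : ∑ d ∈ Y, b * degIn G R d < ∑ _d ∈ Y, a * #R := sum_lt_sum_of_nonempty hY hno
  have h2 : ∑ _r ∈ R, a * #Y ≤ ∑ r ∈ R, b * degIn G Y r := sum_le_sum hR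
  rw [← mul_sum, sum_const, smul_eq_mul] at h1
  rw [sum_const, smul_eq_mul, ← mul_sum] at h2
  rw [sum_degIn_comm] at h1
  nlinarith

lemma exists_dominating [Fintype V] {G : SimpleGraph V} {R Z : Finset V} {b : ℕ}
    (hb : b < Fintype.card V)
    (h : ∀ Z' : Finset V, #Z' ≤ b → ∀ r ∈ R, 13 * #(univ \ Z') ≤ 50 * degIn G (univ \ Z') r)
    (j : ℕ) (hj : #Z + j ≤ b + 1) :
    ∃ D : Finset V, Disjoint D Z ∧ #D ≤ j ∧
      50 ^ j * #{r ∈ R | ∀ d ∈ D, ¬ G.Adj d r} ≤ 37 ^ j * #R := by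
  induction j with
  | zero => exact ⟨∅, by simp, by simp, by simp⟩
  | succ j ih =>
    obtain ⟨D, h1, h2, h3⟩ := ih (by omega)
    have hZD : #(Z ∪ D) ≤ b := by
      have := card_union_le Z D
      omega
    have hne : (univ \ (Z ∪ D)).Nonempty := by
      rw [← card_pos, card_sdiff_of_subset (subset_univ _), card_univ]
      omega
    obtain ⟨d, hd, hd'⟩ := exists_large_degIn (R := {r ∈ R | ∀ d ∈ D, ¬ G.Adj d r}) hne
      fun r hr => h _ hZD r (mem_filter.1 hr).1
    simp only [mem_sdiff, mem_union, mem_univ, true_and, not_or] at hd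
    refine ⟨insert d D, ?_, (card_insert_le _ _).trans (by omega), ?_⟩
    · rw [disjoint_insert_left]
      exact ⟨hd.1, h1⟩
    · have h4 : #{r ∈ R | ∀ e ∈ insert d D, ¬ G.Adj e r} +
          degIn G {r ∈ R | ∀ d ∈ D, ¬ G.Adj d r} d = #{r ∈ R | ∀ d ∈ D, ¬ G.Adj d r} := by
        rw [← card_filter_add_card_filter_not (s := {r ∈ R | ∀ d ∈ D, ¬ G.Adj d r})
          (fun r => G.Adj d r), add_comm]
        congr 1
        rw [filter_filter]
        congr 1
        ext r
        simp only [mem_filter, mem_insert, forall_eq_or_imp]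
        tauto
      rw [pow_succ, pow_succ]
      generalize #{r ∈ R | ∀ d ∈ D, ¬ G.Adj d r} = A at *
      generalize #{r ∈ R | ∀ e ∈ insert d D, ¬ G.Adj e r} = B at *
      have h5 : 50 * B ≤ 37 * A := by omega
      calc 50 ^ j * 50 * B = 50 ^ j * (50 * B) := by ring
        _ ≤ 50 ^ j * (37 * A) := Nat.mul_le_mul_left _ h5
        _ = 37 * (50 ^ j * A) := by ring
        _ ≤ 37 * (37 ^ j * #R) := Nat.mul_le_mul_left _ h3
        _ = 37 ^ j * 37 * #R := by ring

/-- The first `p` values of `f`, followed by the values of `g`. -/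
def append (p : ℕ) (f g : ℕ → V) : ℕ → V := fun i => if i < p then f i else g (i - p)

lemma append_left {p i : ℕ} (f g : ℕ → V) (h : i < p) : append p f g i = f i := if_pos h

lemma append_right {p i : ℕ} (f g : ℕ → V) (h : p ≤ i) : append p f g i = g (i - p) :=
  if_neg (by omega)

lemma append_mem {S : Finset V} {p q : ℕ} {f g : ℕ → V} (hf : ∀ i < p, f i ∈ S)
    (hg : ∀ i < q, g i ∈ S) : ∀ i < p + q, append p f g i ∈ S := by
  intro i hi
  rcases lt_or_ge i p with h | h
  · rw [append_left f g h]; exact hf i h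
  · rw [append_right f g h]; exact hg _ (by omega)

lemma PathOn.append {G : SimpleGraph V} {p q : ℕ} {f g : ℕ → V} (hf : PathOn G p f)
    (hg : PathOn G q g) (hd : ∀ i < p, ∀ j < q, f i ≠ g j) (h : G.Adj (f (p - 1)) (g 0)) :
    PathOn G (p + q) (append p f g) := by
  refine ⟨fun i hi j hj e => ?_, fun i hi => ?_⟩
  · rcases lt_or_ge i p with h1 | h1 <;> rcases lt_or_ge j p with h2 | h2
    · rw [append_left f g h1, append_left f g h2] at e
      exact hf.inj i h1 j h2 e
    · rw [append_left f g h1, append_right f g h2] at e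
      exact (hd _ h1 _ (by omega) e).elim
    · rw [append_right f g h1, append_left f g h2] at e
      exact (hd _ h2 _ (by omega) e.symm).elim
    · rw [append_right f g h1, append_right f g h2] at e
      have := hg.inj _ (by omega) _ (by omega) e
      omega
  · rcases lt_or_ge i p with h1 | h1
    · rcases lt_or_ge (i + 1) p with h2 | h2
      · rw [append_left f g h1, append_left f g h2]
        exact hf.adj i h2
      · rw [append_left f g h1, append_right f g h2, show i = p - 1 by omega,
          show p - 1 + 1 - p = 0 by omega]
        exact h
    · rw [append_right f g h1, append_right f g (by omega : p ≤ i + 1),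
        show i + 1 - p = i - p + 1 by omega]
      exact hg.adj _ (by omega)

lemma PathOn.append_cycleOn {G : SimpleGraph V} {p q : ℕ} {f g : ℕ → V} (hf : PathOn G p f)
    (hg : PathOn G q g) (hd : ∀ i < p, ∀ j < q, f i ≠ g j) (hp : 0 < p) (hq : 0 < q)
    (h : G.Adj (f (p - 1)) (g 0)) (h' : G.Adj (g (q - 1)) (f 0)) :
    CycleOn G (p + q) (RamseyCycle.append p f g) := by
  refine ⟨hf.append hg hd h, ?_⟩
  rw [append_left f g hp, append_right f g (by omega), show p + q - 1 - p = q - 1 by omega]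
  exact h'

lemma pathOn_list {G : SimpleGraph V} (l : List V) (d : V) (h1 : l.Nodup)
    (h2 : l.IsChain G.Adj) : PathOn G l.length (fun i => l.getD i d) := by
  refine ⟨fun i hi j hj e => ?_, fun i hi => ?_⟩
  · simp only [List.getD_eq_getElem _ _ hi, List.getD_eq_getElem _ _ hj] at e
    exact (h1.getElem_inj_iff).1 e
  · simp only [List.getD_eq_getElem _ _ hi, List.getD_eq_getElem _ _ (by omega : i < l.length)]
    exact List.isChain_iff_getElem.1 h2 i hi

lemma pathOn_const (G : SimpleGraph V) (v : V) : PathOn G 1 (fun _ => v) :=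
  ⟨fun i hi j hj _ => by omega, fun i hi => by omega⟩

lemma spans_of_card_ge [Finite V] {G : SimpleGraph V} {n : ℕ} (hn : 3 ≤ n) {A A₀ : Finset V}
    (hA₀ : A₀ ⊆ A) (h0 : n ≤ #A₀ + 600) (hc : ∀ a ∈ A₀, n + 10 ≤ 2 * degIn G A₀ a)
    (hc' : ∀ a ∈ A₀, 2 * #A₀ ≤ n + 2 * degIn G A₀ a) (hA : ∀ a ∈ A, 700 ≤ degIn G A₀ a)
    (hcard : n ≤ #A) : HasCycleLength G n := by
  rcases le_total n #A₀ with h | h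
  · obtain ⟨K, hK, rfl⟩ := exists_subset_card_eq h
    refine (spans_of_growth hn Subset.rfl Subset.rfl (fun v hv => ?_)
      (fun v hv hv' => (hv' hv).elim) (fun v hv hv' => (hv' hv).elim)).hasCycleLength hn
    have h1 := degIn_le_sdiff_add G A₀ (A₀ \ K) v
    rw [Finset.sdiff_sdiff_eq_self hK, card_sdiff_of_subset hK] at h1
    have := hc' v (hK hv)
    omega
  · obtain ⟨K, hK0, hKA, rfl⟩ := exists_subsuperset_card_eq hA₀ h hcard
    refine (spans_of_growth hn hK0 Subset.rfl (fun v hv => ?_)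
      (fun v hv hv' => ?_) (fun v hv hv' => (hv' hv).elim)).hasCycleLength hn
    · have := degIn_mono G hK0 v
      have := hc v hv
      omega
    · have := degIn_mono G hK0 v
      have := hA v (hKA hv)
      omega

lemma spans_of_insert [Finite V] {G : SimpleGraph V} {n : ℕ} (hn : 3 ≤ n) {A A₀ : Finset V}
    (hA₀ : A₀ ⊆ A) (h0 : n ≤ #A₀ + 600) (hc : ∀ a ∈ A₀, n + 10 ≤ 2 * degIn G A₀ a)
    (hA : ∀ a ∈ A, 700 ≤ degIn G A₀ a) (hcard : #A + 1 = n) {z : V} (hz : z ∉ A)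
    (hzA : 2 ≤ degIn G A z) : HasCycleLength G n := by
  have hK : #(insert z A) = n := by rw [card_insert_of_notMem hz, hcard]
  rw [← hK] at hn ⊢
  have hsub : A ⊆ insert z A := subset_insert z A
  refine (spans_of_growth hn hA₀ hsub (fun v hv => ?_)
      (fun v hv hv' => ?_) (fun v hv hv' => ?_)).hasCycleLength hn
  · have := degIn_mono G (hA₀.trans hsub) v
    have := hc v hv
    omega
  · have := degIn_mono G (hA₀.trans hsub) v
    have := hA v hv
    omega
  · obtain rfl : v = z := (mem_insert.1 hv).resolve_right hv'
    have := degIn_mono G hsub v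
    omega

lemma exists_short_path {G : SimpleGraph V} {n : ℕ} {B B₀ : Finset V}
    (hB₀ : B₀ ⊆ B) (hc : ∀ b ∈ B₀, n + 10 ≤ 2 * degIn G B₀ b)
    (hB : ∀ b ∈ B, 700 ≤ degIn G B₀ b) (hcard : #B + 1 = n) {q₁ q₂ : V} (h1 : q₁ ∈ B)
    (h2 : q₂ ∈ B) (h12 : q₁ ≠ q₂) :
    ∃ m f, 4 ≤ m ∧ m ≤ 5 ∧ PathOn G m f ∧ f 0 = q₁ ∧ f (m - 1) = q₂ ∧ ∀ i < m, f i ∈ B := by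
  have nb : ∀ q ∈ B, ∀ X : Finset V, #X ≤ 600 → ∃ y ∈ B₀, G.Adj q y ∧ y ∉ X := by
    intro q hq X hX
    have h3 := degIn_le_sdiff_add G B₀ X q
    have h4 := hB q hq
    have h5 : 0 < degIn G (B₀ \ X) q := by omega
    obtain ⟨y, hy⟩ := card_pos.1 h5
    rw [mem_filter, mem_sdiff] at hy
    exact ⟨y, hy.1.1, hy.2, hy.1.2⟩
  obtain ⟨y, hy, hqy, hyX⟩ := nb q₁ h1 {q₁, q₂} (card_le_two.trans (by norm_num))
  obtain ⟨y', hy', hqy', hyX'⟩ := nb q₂ h2 {q₁, q₂, y} (card_le_three.trans (by norm_num))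
  simp only [mem_insert, mem_singleton, not_or] at hyX hyX'
  by_cases hyy : G.Adj y y'
  · refine ⟨4, _, le_rfl, by norm_num, pathOn_list [q₁, y, y', q₂] q₁ ?_ ?_, rfl, rfl, ?_⟩
    · simp only [List.nodup_cons, List.mem_cons, List.not_mem_nil, or_false, not_or,
        not_false_eq_true, List.nodup_nil, and_true]
      exact ⟨⟨Ne.symm hyX.1, Ne.symm hyX'.1, h12⟩, ⟨Ne.symm hyX'.2.2, hyX.2⟩, hyX'.2.1⟩
    · simp [hqy, hyy, hqy'.symm]
    · intro i hi
      interval_cases i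
      exacts [h1, hB₀ hy, hB₀ hy', h2]
  · have hw : ∃ w ∈ B₀, G.Adj y w ∧ G.Adj y' w ∧ w ≠ q₁ ∧ w ≠ q₂ := by
      by_contra! hno
      have e1 : degIn G B₀ y + degIn G B₀ y' ≤ #(B₀ \ {y, y'}) + #({q₁, q₂} : Finset V) := by
        unfold degIn
        rw [← card_union_add_card_inter]
        refine Nat.add_le_add (card_le_card fun w hw => ?_) (card_le_card fun w hw => ?_)
        · simp only [mem_union, mem_filter, mem_sdiff, mem_insert, mem_singleton] at hw ⊢
          rcases hw with hw | hw
          · refine ⟨hw.1, ?_⟩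
            rintro (rfl | rfl)
            · exact G.irrefl hw.2
            · exact hyy hw.2
          · refine ⟨hw.1, ?_⟩
            rintro (rfl | rfl)
            · exact hyy hw.2.symm
            · exact G.irrefl hw.2
        · simp only [mem_inter, mem_filter, mem_insert, mem_singleton] at hw ⊢
          by_contra! hq
          exact hq.2 (hno w hw.1.1 hw.1.2 hw.2.2 hq.1)
      have e2 : #(B₀ \ {y, y'}) + 2 = #B₀ := by
        rw [card_sdiff_of_subset (by simp [insert_subset_iff, hy, hy']),
          card_pair (Ne.symm hyX'.2.2)]
        have : #({y, y'} : Finset V) ≤ #B₀ := card_le_card (by simp [insert_subset_iff, hy, hy'])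
        rw [card_pair (Ne.symm hyX'.2.2)] at this
        omega
      have e3 := card_le_two (a := q₁) (b := q₂)
      have e4 := card_le_card hB₀
      have e5 := hc y hy
      have e6 := hc y' hy'
      omega
    obtain ⟨w, hw, hw1, hw2, hw3, hw4⟩ := hw
    refine ⟨5, _, by norm_num, le_rfl, pathOn_list [q₁, y, w, y', q₂] q₁ ?_ ?_, rfl, rfl, ?_⟩
    · simp only [List.nodup_cons, List.mem_cons, List.not_mem_nil, or_false, not_or,
        not_false_eq_true, List.nodup_nil, and_true]
      exact ⟨⟨Ne.symm hyX.1, Ne.symm hw3, Ne.symm hyX'.1, h12⟩,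
        ⟨hw1.ne, Ne.symm hyX'.2.2, hyX.2⟩, ⟨hw2.ne.symm, hw4⟩, hyX'.2.1⟩
    · simp [hqy, hw1, hw2.symm, hqy'.symm]
    · intro i hi
      interval_cases i
      exacts [h1, hB₀ hy, hB₀ hw, hB₀ hy', h2]

lemma hasCycleLength_of_cross_edges [Finite V] {G : SimpleGraph V} {n : ℕ} (hn : 20 ≤ n)
    {A A₀ : Finset V} (hA₀ : A₀ ⊆ A) (h0 : n ≤ #A₀ + 600)
    (hc : ∀ a ∈ A₀, n + 10 ≤ 2 * degIn G A₀ a) (hA : ∀ a ∈ A, 700 ≤ degIn G A₀ a)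
    (hcard : #A + 1 = n) {m : ℕ} {f : ℕ → V} (hm : 4 ≤ m) (hm' : m ≤ 5) (hf : PathOn G m f)
    (hfA : ∀ i < m, f i ∉ A) {p₁ p₂ : V} (h1 : p₁ ∈ A) (h2 : p₂ ∈ A) (h12 : p₁ ≠ p₂)
    (a1 : G.Adj p₁ (f 0)) (a2 : G.Adj (f (m - 1)) p₂) : HasCycleLength G n := by
  obtain ⟨A', hA1, hA2, hA3⟩ := exists_subsuperset_card_eq (s := {p₁, p₂}) (t := A)
    (n := n - m) (by simp [insert_subset_iff, h1, h2]) (by rw [card_pair h12]; omega) (by omega)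
  set P := (range m).image f with hP
  have hPc : #P = m := by
    rw [hP, card_image_of_injOn, card_range]
    intro i hi j hj e
    exact hf.inj i (by simpa using hi) j (by simpa using hj) e
  have hAP : Disjoint A' P := by
    rw [Finset.disjoint_left]
    intro x hx hxP
    obtain ⟨i, hi, rfl⟩ := mem_image.1 hxP
    exact hfA i (mem_range.1 hi) (hA2 hx)
  have hK : #(A' ∪ P) = n := by
    rw [card_union_of_disjoint hAP, hA3, hPc]; omega
  have hsd : #(A \ A') ≤ 4 := by
    rw [card_sdiff_of_subset hA2]; omega
  have hK3 : 3 ≤ #(A' ∪ P) := by omega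
  suffices h : Spans G (A' ∪ P) by
    have := h.hasCycleLength hK3
    rwa [hK] at this
  by_contra hG
  obtain ⟨E, hGE, hE, hore⟩ := exists_closure hK3 hG
  have hdeg : ∀ v, degIn G A₀ v ≤ degIn E (A' ∪ P) v + 4 := by
    intro v
    have e1 := degIn_le_sdiff_add G A₀ (A \ A') v
    have e2 : degIn G (A₀ \ (A \ A')) v ≤ degIn G (A' ∪ P) v := by
      refine degIn_mono G (fun x hx => ?_) v
      simp only [mem_sdiff, not_and, not_not] at hx
      exact mem_union_left _ (hx.2 (hA₀ hx.1))
    have e3 := degIn_mono_graph hGE (A' ∪ P) v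
    omega
  have hC : n ≤ #(A₀ ∩ A') + 604 := by
    have e1 : A₀ ⊆ (A₀ ∩ A') ∪ (A \ A') := by
      intro x hx
      simp only [mem_union, mem_inter, mem_sdiff]
      have := hA₀ hx
      tauto
    have := card_le_card e1
    have := card_union_le (A₀ ∩ A') (A \ A')
    omega
  have c0 : ∀ x ∈ A₀ ∩ A', ∀ y ∈ A₀ ∩ A', x ≠ y → E.Adj x y := by
    intro x hx y hy hxy
    rw [mem_inter] at hx hy
    refine hore x (mem_union_left _ hx.2) y (mem_union_left _ hy.2) hxy ?_
    have := hdeg x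
    have := hdeg y
    have := hc x hx.1
    have := hc y hy.1
    omega
  have c1 := clique_grow hore c0 (inter_subset_right) (subset_union_left) fun v hv _ => by
    have := hdeg v
    have := hA v (hA2 hv)
    omega
  have hX : #(A' \ {p₁, p₂}) + 2 = n - m := by
    rw [card_sdiff_of_subset hA1, card_pair h12]; omega
  obtain ⟨g, hg, hgX⟩ := spans_of_clique (E := E) (K := A' \ {p₁, p₂}) (by omega)
    fun x hx y hy hxy => c1 x (mem_sdiff.1 hx).1 y (mem_sdiff.1 hy).1 hxy
  have hp1 : p₁ ∈ A' := hA1 (by simp)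
  have hp2 : p₂ ∈ A' := hA1 (by simp)
  have hgX' : ∀ i < #(A' \ {p₁, p₂}), g i ∈ A' ∧ g i ≠ p₁ ∧ g i ≠ p₂ := fun i hi => by
    simpa using hgX i hi
  generalize #(A' \ {p₁, p₂}) = x at *
  have q1 : PathOn E (1 + x) (append 1 (fun _ => p₂) g) :=
    (pathOn_const E p₂).append hg.toPathOn (fun i _ j hj => ((hgX' j hj).2.2).symm)
      (c1 _ hp2 _ (hgX' 0 (by omega)).1 (hgX' 0 (by omega)).2.2.symm)
  have q2 : PathOn E (1 + x + 1) (append (1 + x) (append 1 (fun _ => p₂) g) (fun _ => p₁)) := by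
    refine q1.append (pathOn_const E p₁) (fun i hi j _ => ?_) ?_
    · rcases lt_or_ge i 1 with h | h
      · rw [append_left _ _ h]; exact h12.symm
      · rw [append_right _ _ h]; exact (hgX' _ (by omega)).2.1
    · rw [append_right _ _ (by omega)]
      exact c1 _ (hgX' _ (by omega)).1 _ hp1 (hgX' _ (by omega)).2.1
  have hmem : ∀ i < 1 + x + 1,
      append (1 + x) (append 1 (fun _ => p₂) g) (fun _ => p₁) i ∈ A' :=
    append_mem (append_mem (fun _ _ => hp2) (fun i hi => (hgX' i hi).1)) (fun _ _ => hp1)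
  have hlen : m + (1 + x + 1) = #(A' ∪ P) := by omega
  have hfP : ∀ i < m, f i ∈ P := fun i hi => mem_image_of_mem f (mem_range.2 hi)
  refine hE ⟨append m f (append (1 + x) (append 1 (fun _ => p₂) g) (fun _ => p₁)), ?_, ?_⟩
  · rw [← hlen]
    refine (hf.mono_graph hGE).append_cycleOn q2 (fun i hi j hj e => ?_) (by omega) (by omega)
      ?_ ?_
    · exact Finset.disjoint_left.1 hAP (hmem j hj) (e ▸ hfP i hi)
    · rw [append_left _ _ (by omega), append_left _ _ one_pos]
      exact hGE a2
    · rw [append_right _ _ (by omega)]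
      exact hGE a1
  · rw [← hlen]
    exact append_mem (fun i hi => mem_union_right _ (hfP i hi))
      (fun i hi => mem_union_left _ (hmem i hi))

lemma hasCycleLength_of_two_cliques [Fintype V] {G : SimpleGraph V} {n : ℕ} (hn : 4516 ≤ n)
    (hV : Fintype.card V = 2 * n - 1)
    (hpair : ∀ u v, u ≠ v → n ≤ #{w | w = u ∨ w = v ∨ G.Adj u w ∨ G.Adj v w})
    {z : V} {A B A₀ B₀ : Finset V} (hAB : Disjoint A B) (hzA : z ∉ A) (hzB : z ∉ B)
    (hcov : ∀ v, v ≠ z → v ∈ A ∨ v ∈ B) (hA₀ : A₀ ⊆ A) (hB₀ : B₀ ⊆ B)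
    (hA0 : n ≤ #A₀ + 600) (hB0 : n ≤ #B₀ + 600)
    (hcA : ∀ a ∈ A₀, n + 10 ≤ 2 * degIn G A₀ a) (hcB : ∀ b ∈ B₀, n + 10 ≤ 2 * degIn G B₀ b)
    (hcA' : ∀ a ∈ A₀, 2 * #A₀ ≤ n + 2 * degIn G A₀ a)
    (hcB' : ∀ b ∈ B₀, 2 * #B₀ ≤ n + 2 * degIn G B₀ b)
    (hA : ∀ a ∈ A, 700 ≤ degIn G A₀ a) (hB : ∀ b ∈ B, 700 ≤ degIn G B₀ b) :
    HasCycleLength G n := by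
  rcases le_or_gt n #A with h | hAn
  · exact spans_of_card_ge (by omega) hA₀ hA0 hcA hcA' hA h
  rcases le_or_gt n #B with h | hBn
  · exact spans_of_card_ge (by omega) hB₀ hB0 hcB hcB' hB h
  have htot : #A + #B + 1 = 2 * n - 1 := by
    have e : insert z (A ∪ B) = univ := by
      ext v
      simp only [mem_insert, mem_union, mem_univ, iff_true]
      by_cases hv : v = z
      · exact Or.inl hv
      · exact Or.inr (hcov v hv)
    rw [← hV, ← card_univ, ← e, card_insert_of_notMem (by simp [hzA, hzB]),
      card_union_of_disjoint hAB]
  have hA1 : #A + 1 = n := by omega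
  have hB1 : #B + 1 = n := by omega
  rcases le_or_gt 2 (degIn G A z) with h | hzA2
  · exact spans_of_insert (by omega) hA₀ hA0 hcA hA hA1 hzA h
  rcases le_or_gt 2 (degIn G B z) with h | hzB2
  · exact spans_of_insert (by omega) hB₀ hB0 hcB hB hB1 hzB h
  have cross : ∀ C D : Finset V, #C + 1 = n → degIn G C z < 2 →
      (∀ v, v ≠ z → v ∈ C ∨ v ∈ D) → z ∉ C →
      ∀ x, ∃ a ∈ C, a ≠ x ∧ ∃ b ∈ D, G.Adj a b := by
    intro C D hC1 hz hcov hzC x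
    by_contra! hno
    have h1 : 1 < #((C.erase x) \ {w ∈ C | G.Adj z w}) := by
      have e1 := le_card_sdiff {w ∈ C | G.Adj z w} (C.erase x)
      have e2 := pred_card_le_card_erase (s := C) (a := x)
      unfold degIn at hz
      omega
    obtain ⟨u, hu, v, hv, huv⟩ := one_lt_card.1 h1
    simp only [mem_sdiff, mem_erase, mem_filter, not_and] at hu hv
    have h2 := hpair u v huv
    have h3 : ({w | w = u ∨ w = v ∨ G.Adj u w ∨ G.Adj v w} : Finset V) ⊆ C := by
      intro w hw
      rw [mem_filter] at hw
      by_contra hwC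
      rcases hw.2 with rfl | rfl | hw' | hw'
      · exact hwC hu.1.2
      · exact hwC hv.1.2
      · by_cases hwz : w = z
        · subst hwz; exact hu.2 hu.1.2 hw'.symm
        · exact hno u hu.1.2 hu.1.1 w ((hcov w hwz).resolve_left hwC) hw'
      · by_cases hwz : w = z
        · subst hwz; exact hv.2 hv.1.2 hw'.symm
        · exact hno v hv.1.2 hv.1.1 w ((hcov w hwz).resolve_left hwC) hw'
    have := card_le_card h3
    omega
  have hcov' : ∀ v, v ≠ z → v ∈ B ∨ v ∈ A := fun v hv => (hcov v hv).symm
  have hedges : ∃ p₁ ∈ A, ∃ p₂ ∈ A, ∃ q₁ ∈ B, ∃ q₂ ∈ B, p₁ ≠ p₂ ∧ q₁ ≠ q₂ ∧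
      G.Adj p₁ q₁ ∧ G.Adj p₂ q₂ := by
    obtain ⟨a₁, ha1, -, b₁, hb1, e1⟩ := cross A B hA1 hzA2 hcov hzA z
    obtain ⟨b₂, hb2, hb12, c, hcA, e2⟩ := cross B A hB1 hzB2 hcov' hzB b₁
    by_cases hc : c = a₁
    · subst hc
      obtain ⟨a₂, ha2, ha12, b, hb, e3⟩ := cross A B hA1 hzA2 hcov hzA c
      by_cases hbb : b = b₁
      · subst hbb
        exact ⟨c, hcA, a₂, ha2, b₂, hb2, b, hb, ha12.symm, hb12, e2.symm, e3⟩
      · exact ⟨c, hcA, a₂, ha2, b₁, hb1, b, hb, ha12.symm, Ne.symm hbb, e1, e3⟩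
    · exact ⟨a₁, ha1, c, hcA, b₁, hb1, b₂, hb2, Ne.symm hc, hb12.symm, e1, e2.symm⟩
  obtain ⟨p₁, hp1, p₂, hp2, q₁, hq1, q₂, hq2, hp, hq, e1, e2⟩ := hedges
  obtain ⟨m, f, hm, hm', hf, rfl, rfl, hfB⟩ := exists_short_path hB₀ hcB hB hB1 hq1 hq2 hq
  exact hasCycleLength_of_cross_edges (by omega) hA₀ hA0 hcA hA hA1 hm hm' hf
    (fun i hi h => Finset.disjoint_left.1 hAB h (hfB i hi)) hp1 hp2 hp e1 e2.symm

lemma PathOn.le_card {G : SimpleGraph V} {p : ℕ} {f : ℕ → V} (hf : PathOn G p f) {H : Finset V}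
    (hH : ∀ i < p, f i ∈ H) : p ≤ #H := by
  have : #((range p).image f) = p := by
    rw [card_image_of_injOn, card_range]
    intro i hi j hj e
    exact hf.inj i (by simpa using hi) j (by simpa using hj) e
  rw [← this]
  refine card_le_card fun x hx => ?_
  obtain ⟨i, hi, rfl⟩ := mem_image.1 hx
  exact hH i (mem_range.1 hi)

/-- `f` lists a path of `G` inside `H` having the largest possible number `p` of vertices. -/
structure LongestPath (G : SimpleGraph V) (H : Finset V) (p : ℕ) (f : ℕ → V) : Prop extends
    PathOn G p f where
  mem : ∀ i < p, f i ∈ H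
  max : ∀ q g, PathOn G q g → (∀ i < q, g i ∈ H) → q ≤ p

lemma exists_longestPath (G : SimpleGraph V) {H : Finset V} (hH : H.Nonempty) :
    ∃ p f, 0 < p ∧ LongestPath G H p f := by
  obtain ⟨v, hv⟩ := hH
  let P : ℕ → Prop := fun p => ∃ f, PathOn G p f ∧ ∀ i < p, f i ∈ H
  have h1 : P 1 := ⟨_, pathOn_const G v, fun _ _ => hv⟩
  have hb : ∀ p, P p → p ≤ #H := fun p ⟨f, hf, hfH⟩ => hf.le_card hfH
  obtain ⟨f, hf, hfH⟩ := Nat.findGreatest_spec (hb 1 h1) h1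
  exact ⟨_, f, Nat.le_findGreatest (hb 1 h1) h1, hf, hfH,
    fun q g hg hgH => Nat.le_findGreatest (hb q ⟨g, hg, hgH⟩) ⟨g, hg, hgH⟩⟩

lemma LongestPath.degIn_le {G : SimpleGraph V} {H : Finset V} {p : ℕ} {f : ℕ → V}
    (hf : LongestPath G H p f) :
    degIn G H (f 0) ≤ #{i ∈ range p | G.Adj (f 0) (f i)} := by
  refine (card_le_card fun w hw => ?_).trans (card_image_le (f := f))
  rw [mem_filter] at hw
  by_contra hn
  have hn' : ∀ i < p, w ≠ f i := by
    rintro i hi rfl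
    exact hn (mem_image_of_mem f (by rw [mem_filter, mem_range]; exact ⟨hi, hw.2⟩))
  have := hf.max (1 + p) (append 1 (fun _ => w) f)
    ((pathOn_const G w).append hf.toPathOn (fun _ _ j hj => hn' j hj) hw.2.symm)
    (append_mem (fun _ _ => hw.1) hf.mem)
  omega

lemma LongestPath.reverse {G : SimpleGraph V} {H : Finset V} {p : ℕ} {f : ℕ → V}
    (hf : LongestPath G H p f) : LongestPath G H p (fun i => f (p - 1 - i)) :=
  ⟨hf.toPathOn.reverse, fun i hi => hf.mem _ (by omega), hf.max⟩

lemma LongestPath.degIn_last_le {G : SimpleGraph V} {H : Finset V} {p : ℕ} {f : ℕ → V}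
    (hf : LongestPath G H p f) :
    degIn G H (f (p - 1)) ≤ #{i ∈ range p | G.Adj (f (p - 1)) (f i)} := by
  refine (hf.reverse.degIn_le).trans ?_
  rw [← card_image_of_injOn (f := fun i => p - 1 - i)]
  · refine card_le_card fun x hx => ?_
    simp only [mem_image, mem_filter, mem_range] at hx ⊢
    obtain ⟨i, ⟨h1, h2⟩, rfl⟩ := hx
    exact ⟨by omega, by simpa using h2⟩
  · intro i hi j hj e
    simp only [coe_filter, mem_range, Set.mem_ofPred_eq] at hi hj e
    omega

lemma LongestPath.le_or {G : SimpleGraph V} {H : Finset V} {p δ : ℕ} {f : ℕ → V}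
    (hf : LongestPath G H p f) (hp : 0 < p) (hδ : ∀ v ∈ H, δ ≤ degIn G H v)
    (hconn : ∀ X ⊆ H, X.Nonempty → (∀ x ∈ X, ∀ y ∈ H, G.Adj x y → y ∈ X) → X = H) :
    #H ≤ p ∨ 2 * δ + 1 ≤ p := by
  by_contra! hno
  have d1 := (hδ _ (hf.mem 0 hp)).trans hf.degIn_le
  have d2 := (hδ _ (hf.mem (p - 1) (by omega))).trans hf.degIn_last_le
  obtain ⟨k, hk, hkp, a1, a2⟩ := PathOn.exists_crossing (G := G) (p := p) (f := f)
    (Finset.Ico 1 p) (fun i hi ha => by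
      rw [Finset.mem_Ico]
      refine ⟨?_, hi⟩
      by_contra h0
      rw [show i = 0 by omega] at ha
      exact G.irrefl ha) (fun i hi _ => by rw [Finset.mem_Ico]; omega)
    (by rw [Nat.card_Ico]; omega)
  have hc := hf.toPathOn.cycleOn_of_crossing hk hkp a1 a2
  have hcH : ∀ i < p, rotateFirst f k i ∈ H := fun i hi => by
    unfold rotateFirst
    split_ifs
    · exact hf.mem _ (by omega)
    · exact hf.mem _ hi
  generalize rotateFirst f k = g at hc hcH
  have hK : (range p).image g ≠ H := by
    intro e
    have := card_image_le (s := range p) (f := g)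
    rw [e, card_range] at this
    omega
  have hKH : (range p).image g ⊆ H := fun x hx => by
    obtain ⟨i, hi, rfl⟩ := mem_image.1 hx
    exact hcH i (mem_range.1 hi)
  have : ∃ j < p, ∃ y ∈ H, G.Adj (g j) y ∧ ∀ i < p, y ≠ g i := by
    by_contra! hn
    refine hK (hconn _ hKH ⟨g 0, mem_image_of_mem g (mem_range.2 hp)⟩ fun x hx y hy hxy => ?_)
    obtain ⟨i, hi, rfl⟩ := mem_image.1 hx
    obtain ⟨j, hj, rfl⟩ := hn i (mem_range.1 hi) y hy hxy
    exact mem_image_of_mem g (mem_range.2 hj)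
  obtain ⟨j, hj, y, hy, hjy, hyg⟩ := this
  have := hf.max (1 + p) _ ((pathOn_const G y).append (hc.shift j hj).toPathOn
    (fun _ _ i hi => by
      split_ifs
      · exact hyg _ (by assumption)
      · exact hyg _ (by omega)) (by rw [if_pos (by omega), zero_add]; exact hjy.symm))
    (append_mem (fun _ _ => hy) (fun i hi => by
      split_ifs
      · exact hcH _ (by assumption)
      · exact hcH _ (by omega)))
  omega

lemma exists_index_notMem {f : ℕ → V} {I : Finset ℕ}
    (hf : ∀ i ∈ I, ∀ j ∈ I, f i = f j → i = j) {R : Finset V} (h : #R < #I) :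
    ∃ i ∈ I, f i ∉ R := by
  by_contra! hno
  have := card_le_card_of_injOn f hno fun i hi j hj e => hf i hi j hj e
  omega

lemma LongestPath.exists_path_of_card {G : SimpleGraph V} {H R₁ R₂ : Finset V} {p q δ U : ℕ}
    {f : ℕ → V} (hf : LongestPath G H p f) (hq : 0 < q) (hqp : q ≤ p)
    (hδ : ∀ v ∈ H, δ ≤ degIn G H v) (h1 : #R₁ ≤ U) (h2 : #R₂ ≤ U) (hU : 3 * U < δ) :
    ∃ g, PathOn G q g ∧ (∀ i < q, g i ∈ H) ∧ g 0 ∉ R₁ ∧ g (q - 1) ∉ R₂ := by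
  rcases lt_or_ge (#R₁ + #R₂) (p - q + 1) with hlt | hge
  · have : ∃ i ∈ range (p - q + 1), f i ∉ R₁ ∧ f (i + (q - 1)) ∉ R₂ := by
      by_contra! hno
      have e1 : range (p - q + 1) ⊆ {i ∈ range (p - q + 1) | f i ∈ R₁} ∪
          {i ∈ range (p - q + 1) | f (i + (q - 1)) ∈ R₂} := by
        intro i hi
        have := hno i hi
        simp only [mem_union, mem_filter, hi, true_and]
        tauto
      have e2 := (card_le_card e1).trans (card_union_le _ _)
      have e3 : #{i ∈ range (p - q + 1) | f i ∈ R₁} ≤ #R₁ := by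
        refine card_le_card_of_injOn f (fun i hi => (mem_filter.1 hi).2) fun i hi j hj e => ?_
        simp only [coe_filter, mem_range, Set.mem_ofPred_eq] at hi hj
        exact hf.inj i (by omega) j (by omega) e
      have e4 : #{i ∈ range (p - q + 1) | f (i + (q - 1)) ∈ R₂} ≤ #R₂ := by
        refine card_le_card_of_injOn (fun i => f (i + (q - 1)))
          (fun i hi => (mem_filter.1 hi).2) fun i hi j hj e => ?_
        simp only [coe_filter, mem_range, Set.mem_ofPred_eq] at hi hj
        have := hf.inj _ (by omega) _ (by omega) e
        omega
      rw [card_range] at e2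
      omega
    obtain ⟨i, hi, hi1, hi2⟩ := this
    rw [mem_range] at hi
    exact ⟨_, hf.toPathOn.drop i q (by omega), fun j hj => hf.mem _ (by omega), hi1, hi2⟩
  · have d1 := (hδ _ (hf.mem 0 (by omega))).trans hf.degIn_le
    have hpos : ∀ i, G.Adj (f 0) (f i) → 0 < i := fun i hi => by
      rcases Nat.eq_zero_or_pos i with rfl | h
      · exact (G.irrefl hi).elim
      · exact h
    obtain ⟨k, hk, hkR⟩ := exists_index_notMem (f := fun i => f (i - 1)) (R := R₁)
      (I := {i ∈ range p | G.Adj (f 0) (f i)}) (fun i hi j hj e => by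
        rw [mem_filter, mem_range] at hi hj
        have := hpos i hi.2
        have := hpos j hj.2
        have := hf.inj _ (by omega) _ (by omega) e
        omega) (by omega)
    rw [mem_filter, mem_range] at hk
    have hk0 := hpos k hk.2
    have hg : LongestPath G H p (rotateFirst f k) := by
      refine ⟨hf.toPathOn.rotateFirst hk.1 hk.2, fun i hi => ?_, hf.max⟩
      unfold rotateFirst
      split_ifs
      · exact hf.mem _ (by omega)
      · exact hf.mem _ hi
    have hg0 : rotateFirst f k 0 ∉ R₁ := by
      unfold rotateFirst
      rw [if_pos hk0]
      simpa using hkR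
    generalize rotateFirst f k = g at hg hg0
    have d2 := (hδ _ (hg.mem (p - 1) (by omega))).trans hg.degIn_last_le
    have d3 : #{i ∈ range p | G.Adj (g (p - 1)) (g i)} ≤
        #{i ∈ range (q - 1) | G.Adj (g (p - 1)) (g i)} + #(Finset.Ico (q - 1) (p - 1)) := by
      refine (card_le_card fun i hi => ?_).trans (card_union_le _ _)
      simp only [mem_union, mem_filter, mem_range, Finset.mem_Ico] at hi ⊢
      have : i ≠ p - 1 := by
        rintro rfl
        exact G.irrefl hi.2
      by_cases hiq : i < q - 1
      · exact Or.inl ⟨hiq, hi.2⟩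
      · right; omega
    rw [Nat.card_Ico] at d3
    obtain ⟨i, hi, hiR⟩ := exists_index_notMem (f := fun i => g (p - q + i + 1))
      (R := R₂) (I := {i ∈ range (q - 1) | G.Adj (g (p - 1)) (g i)}) (fun i hi j hj e => by
        rw [mem_filter, mem_range] at hi hj
        have := hg.inj _ (by omega) _ (by omega) e
        omega) (by omega)
    rw [mem_filter, mem_range] at hi
    refine ⟨_, (hg.toPathOn.rotateLast (k := i + 1) (by omega) (by omega)
      (by simpa using hi.2.symm)).take hqp, fun j hj => ?_, ?_, ?_⟩
    · unfold rotateLast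
      split_ifs
      · exact hg.mem _ (by omega)
      · exact hg.mem _ (by omega)
    · unfold rotateLast
      rwa [if_pos (by omega)]
    · unfold rotateLast
      rw [if_neg (by omega), show p - 1 - (q - 1 - (i + 1)) = p - q + i + 1 by omega]
      exact hiR

/-- Any two closed neighbourhoods of `G` together contain at least `n` vertices. -/
def PairsDominate [Fintype V] (G : SimpleGraph V) (n : ℕ) : Prop :=
  ∀ u v, u ≠ v → n ≤ #{w | w = u ∨ w = v ∨ G.Adj u w ∨ G.Adj v w}

lemma degIn_sdiff_add [Fintype V] (G : SimpleGraph V) (W : Finset V) (v : V) :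
    degIn G univ v ≤ degIn G (univ \ W) v + #W :=
  degIn_le_sdiff_add G univ W v

lemma hasCycleLength_of_closed_pair [Fintype V] {G : SimpleGraph V} {n : ℕ} (hn : 4516 ≤ n)
    (hV : Fintype.card V = 2 * n - 1) (hpair : PairsDominate G n) {z : V}
    (hz : ∀ v, v ≠ z → n ≤ 2 * (degIn G univ v + 1)) {W X Y : Finset V} (hW : #W ≤ 70)
    (hXY : Disjoint X Y) (hWX : Disjoint W X) (hWY : Disjoint W Y)
    (hcov : ∀ v, v ∈ W ∨ v ∈ X ∨ v ∈ Y)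
    (hX0 : X.Nonempty) (hY0 : Y.Nonempty) (hno : ∀ x ∈ X, ∀ y ∈ Y, ¬ G.Adj x y)
    (hdeg : ∀ v, v ∉ W → 57 * n ≤ 100 * degIn G univ v) : HasCycleLength G n := by
  have main : ∀ X Y : Finset V, X.Nonempty → Disjoint W X → (∀ v, v ∈ W ∨ v ∈ X ∨ v ∈ Y) →
      (∀ x ∈ X, ∀ y ∈ Y, ¬ G.Adj x y) →
      (∀ x ∈ X, 57 * n ≤ 100 * (degIn G X x + 70)) ∧ n ≤ #X + 70 := by
    intro X Y hX0 hWX hcov hno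
    have h1 : ∀ x ∈ X, 57 * n ≤ 100 * (degIn G X x + 70) := by
      intro x hx
      have e1 := hdeg x fun h => Finset.disjoint_left.1 hWX h hx
      have e2 : degIn G univ x ≤ degIn G (X ∪ W) x := card_le_card fun w hw => by
        rw [mem_filter] at hw ⊢
        refine ⟨?_, hw.2⟩
        rcases hcov w with h | h | h
        · exact mem_union_right _ h
        · exact mem_union_left _ h
        · exact (hno x hx w h hw.2).elim
      have e3 := degIn_union_le G X W x
      have e4 := degIn_le_card G W x
      omega
    refine ⟨h1, ?_⟩
    obtain ⟨x, hx⟩ := hX0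
    have e1 := h1 x hx
    have e2 := degIn_le_card G X x
    obtain ⟨u, hu, v, hv, huv⟩ := one_lt_card.1 (show 1 < #X by omega)
    have e3 := hpair u v huv
    have e4 : ({w | w = u ∨ w = v ∨ G.Adj u w ∨ G.Adj v w} : Finset V) ⊆ X ∪ W := by
      intro w hw
      rw [mem_filter] at hw
      rcases hcov w with h | h | h
      · exact mem_union_right _ h
      · exact mem_union_left _ h
      · rcases hw.2 with rfl | rfl | hw' | hw'
        · exact mem_union_left _ hu
        · exact mem_union_left _ hv
        · exact (hno u hu w h hw').elim
        · exact (hno v hv w h hw').elim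
    have e5 := card_le_card e4
    have e6 := card_union_le X W
    omega
  obtain ⟨hX1, hX2⟩ := main X Y hX0 hWX hcov hno
  obtain ⟨hY1, hY2⟩ := main Y X hY0 hWY (fun v => by have := hcov v; tauto)
    (fun y hy x hx h => hno x hx y hy h.symm)
  have hXY2 : #X + #Y ≤ 2 * n - 1 := by
    rw [← hV, ← card_union_of_disjoint hXY]
    exact card_le_univ _
  have her : ∀ (X : Finset V) v, degIn G X v ≤ degIn G (X.erase z) v + 1 := by
    intro X v
    have := degIn_le_sdiff_add G X {z} v
    rwa [sdiff_singleton_eq_erase, card_singleton] at this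
  have hXe := pred_card_le_card_erase (s := X) (a := z)
  have hYe := pred_card_le_card_erase (s := Y) (a := z)
  have hXe' := card_erase_le (s := X) (a := z)
  have hYe' := card_erase_le (s := Y) (a := z)
  have hW' : ∀ w, w ≠ z → n ≤ 2 * (degIn G X w + degIn G Y w + 71) := by
    intro w hw
    have e1 := hz w hw
    have e2 : degIn G univ w ≤ degIn G ((X ∪ Y) ∪ W) w := degIn_mono G (fun v _ => by
      have := hcov v
      simp only [mem_union]
      tauto) w
    have e3 := degIn_union_le G (X ∪ Y) W w
    have e4 := degIn_union_le G X Y w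
    have e5 := degIn_le_card G W w
    omega
  refine hasCycleLength_of_two_cliques hn hV hpair (z := z)
    (A := X.erase z ∪ {w ∈ W.erase z | degIn G Y w ≤ degIn G X w})
    (B := Y.erase z ∪ {w ∈ W.erase z | ¬ degIn G Y w ≤ degIn G X w})
    (A₀ := X.erase z) (B₀ := Y.erase z) ?_ (by simp) (by simp) (fun v hv => ?_)
    subset_union_left subset_union_left (by omega) (by omega) (fun a ha => ?_) (fun a ha => ?_)
    (fun a ha => ?_) (fun a ha => ?_) (fun a ha => ?_) (fun a ha => ?_)
  · rw [Finset.disjoint_left]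
    intro x hx hx'
    have d1 : x ∈ X → x ∉ Y := fun h => Finset.disjoint_left.1 hXY h
    have d2 : x ∈ W → x ∉ X := fun h => Finset.disjoint_left.1 hWX h
    have d3 : x ∈ W → x ∉ Y := fun h => Finset.disjoint_left.1 hWY h
    simp only [mem_union, mem_erase, mem_filter] at hx hx'
    tauto
  · have := hcov v
    simp only [mem_union, mem_erase, mem_filter]
    tauto
  · have := hX1 a (mem_of_mem_erase ha)
    have := her X a
    omega
  · have := hY1 a (mem_of_mem_erase ha)
    have := her Y a
    omega
  · have := hX1 a (mem_of_mem_erase ha)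
    have := her X a
    omega
  · have := hY1 a (mem_of_mem_erase ha)
    have := her Y a
    omega
  · have e1 := her X a
    rcases mem_union.1 ha with h | h
    · have := hX1 a (mem_of_mem_erase h)
      omega
    · rw [mem_filter] at h
      have := hW' a (ne_of_mem_erase h.1)
      omega
  · have e1 := her Y a
    rcases mem_union.1 ha with h | h
    · have := hY1 a (mem_of_mem_erase h)
      omega
    · rw [mem_filter] at h
      have := hW' a (ne_of_mem_erase h.1)
      omega

lemma exists_two_dominating [Fintype V] {G : SimpleGraph V} {n : ℕ} (hn : 4516 ≤ n)
    (hV : Fintype.card V = 2 * n - 1) {R Z : Finset V}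
    (hR : ∀ v ∈ R, 57 * n ≤ 100 * degIn G univ v) (hZ : #Z ≤ 226) :
    ∃ D₁ D₂ : Finset V, Disjoint D₁ Z ∧ Disjoint D₂ Z ∧ Disjoint D₁ D₂ ∧ #D₁ ≤ 8 ∧ #D₂ ≤ 8 ∧
      50 ^ 8 * #{r ∈ R | ∀ d ∈ D₁, ¬ G.Adj d r} ≤ 37 ^ 8 * (2 * n - 1) ∧
      50 ^ 8 * #{r ∈ R | ∀ d ∈ D₂, ¬ G.Adj d r} ≤ 37 ^ 8 * (2 * n - 1) := by
  have hstep : ∀ Z' : Finset V, #Z' ≤ 241 → ∀ r ∈ R,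
      13 * #(univ \ Z') ≤ 50 * degIn G (univ \ Z') r := by
    intro Z' hZ' r hr
    have e1 := degIn_sdiff_add G Z' r
    have e2 := hR r hr
    have e3 : #(univ \ Z') + #Z' = 2 * n - 1 := by
      rw [card_sdiff_add_card_eq_card (subset_univ _), card_univ, hV]
    omega
  have hRc : #R ≤ 2 * n - 1 := hV ▸ card_le_univ R
  obtain ⟨D₁, a1, a2, a3⟩ := exists_dominating (Z := Z) (by omega) hstep 8 (by omega)
  have hZ1 := card_union_le Z D₁
  obtain ⟨D₂, b1, b2, b3⟩ := exists_dominating (Z := Z ∪ D₁) (by omega) hstep 8 (by omega)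
  rw [disjoint_union_right] at b1
  exact ⟨D₁, D₂, a1, b1.1, b1.2.symm, a2, b2, a3.trans (Nat.mul_le_mul_left _ hRc),
    b3.trans (Nat.mul_le_mul_left _ hRc)⟩

lemma exists_linking [Fintype V] {G : SimpleGraph V} {h : V} {D : Finset V} (hD : #D ≤ 16)
    (hh : h ∉ D)
    (hDS : ∀ d ∈ D, 33 ≤ degIn G {v | 48 ≤ #{w | G.Adj v w ∧ G.Adj h w}} d) :
    ∃ s x : V → V, ∃ W : Finset V, #W ≤ 49 ∧ h ∈ W ∧ D ⊆ W ∧ (∀ d ∈ D, s d ∈ W ∧ x d ∈ W) ∧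
      ∀ d ∈ D, ∀ e ∈ D, d ≠ e →
        [e, s e, x e, h, x d, s d, d].Nodup ∧ [e, s e, x e, h, x d, s d, d].IsChain G.Adj := by
  have : Nonempty V := ⟨h⟩
  obtain ⟨s, s1, s2⟩ := exists_distinct_representatives D
    (fun d => {w ∈ ({v | 48 ≤ #{w | G.Adj v w ∧ G.Adj h w}} : Finset V) | G.Adj d w})
    (insert h D) (fun d hd => by
      have e1 := hDS d hd
      have e2 := card_insert_le h D
      unfold degIn at e1
      omega)
  simp only [mem_filter, mem_univ, true_and, mem_insert, not_or] at s2
  obtain ⟨x, x1, x2⟩ := exists_distinct_representatives D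
    (fun d => ({w | G.Adj (s d) w ∧ G.Adj h w} : Finset V)) (D ∪ D.image s) (fun d hd => by
      have := (s2 d hd).1.1
      have := card_union_le D (D.image s)
      have := card_image_le (s := D) (f := s)
      omega)
  simp only [mem_filter, mem_univ, true_and, mem_union, not_or, mem_image, not_exists,
    not_and] at x2
  refine ⟨s, x, insert h (D ∪ (D.image s ∪ D.image x)), ?_, mem_insert_self _ _, ?_, ?_, ?_⟩
  · have := card_insert_le h (D ∪ (D.image s ∪ D.image x))
    have := card_union_le D (D.image s ∪ D.image x)
    have := card_union_le (D.image s) (D.image x)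
    have := card_image_le (s := D) (f := s)
    have := card_image_le (s := D) (f := x)
    omega
  · exact subset_union_left.trans (subset_insert _ _)
  · intro d hd
    exact ⟨mem_insert_of_mem (mem_union_right _ (mem_union_left _ (mem_image_of_mem s hd))),
      mem_insert_of_mem (mem_union_right _ (mem_union_right _ (mem_image_of_mem x hd)))⟩
  · intro d hd e he hde
    obtain ⟨⟨-, d1⟩, d2, d3⟩ := s2 d hd
    obtain ⟨⟨-, e1⟩, e2, e3⟩ := s2 e he
    obtain ⟨⟨d4, d5⟩, d6, d7⟩ := x2 d hd
    obtain ⟨⟨e4, e5⟩, e6, e7⟩ := x2 e he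
    constructor
    · simp only [List.nodup_cons, List.mem_cons, List.not_mem_nil, or_false, not_or,
        not_false_eq_true, List.nodup_nil, and_true]
      refine ⟨⟨?_, ?_, ?_, ?_, ?_, ?_⟩, ⟨?_, ?_, ?_, ?_, ?_⟩, ⟨?_, ?_, ?_, ?_⟩, ⟨?_, ?_, ?_⟩,
        ⟨?_, ?_⟩, ?_⟩
      · rintro h; exact e3 (h ▸ he)
      · rintro h; exact e6 (h ▸ he)
      · rintro h; exact hh (h ▸ he)
      · rintro h; exact d6 (h ▸ he)
      · rintro h; exact d3 (h ▸ he)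
      · exact hde.symm
      · exact e7 e he
      · exact e2
      · exact d7 e he
      · exact fun h => hde (s1 e he d hd h).symm
      · intro h; exact e3 (h ▸ hd)
      · exact e5.ne.symm
      · exact fun h => hde (x1 e he d hd h).symm
      · exact (e7 d hd ·.symm)
      · intro h; exact e6 (h ▸ hd)
      · exact d5.ne
      · exact Ne.symm d2
      · intro h; exact hh (h ▸ hd)
      · exact (d7 d hd ·.symm)
      · intro h; exact d6 (by rw [h]; exact hd)
      · intro h; exact d3 (by rw [h]; exact hd)
    · simp [e1, e4, e5.symm, d5, d4.symm, d1.symm]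

lemma hasCycleLength_of_few_bad [Fintype V] {G : SimpleGraph V} {n : ℕ} (hn : 4516 ≤ n)
    (hV : Fintype.card V = 2 * n - 1) (hpair : PairsDominate G n) {z : V}
    (hz : ∀ v, v ≠ z → n ≤ 2 * (degIn G univ v + 1))
    (hL : #{v | ¬ 57 * n ≤ 100 * degIn G univ v} ≤ 21) (h : V)
    (hG : #{v | degIn G {v | 48 ≤ #{w | G.Adj v w ∧ G.Adj h w}} v < 33} ≤ 225) :
    HasCycleLength G n := by
  set L : Finset V := {v | ¬ 57 * n ≤ 100 * degIn G univ v} with hLdef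
  set B : Finset V := {v | degIn G {v | 48 ≤ #{w | G.Adj v w ∧ G.Adj h w}} v < 33} with hB
  have hLm : ∀ v, v ∉ L → 57 * n ≤ 100 * degIn G univ v := fun v hv => by
    simpa [hLdef] using hv
  obtain ⟨D₁, D₂, z1, z2, hD, c1, c2, r1, r2⟩ := exists_two_dominating hn hV
    (R := univ \ L) (Z := insert h B) (fun v hv => hLm v (by simpa using hv))
    ((card_insert_le _ _).trans (by omega))
  have hDZ : Disjoint (D₁ ∪ D₂) (insert h B) := disjoint_union_left.2 ⟨z1, z2⟩
  have hDZ' : ∀ d ∈ D₁ ∪ D₂, d ≠ h ∧ d ∉ B := fun d hd => by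
    simpa using Finset.disjoint_left.1 hDZ hd
  obtain ⟨s, x, W, w1, w2, w3, w4, w5⟩ := exists_linking (G := G) (h := h) (D := D₁ ∪ D₂)
    ((card_union_le _ _).trans (by omega)) (fun hh => (hDZ' h hh).1 rfl)
    (fun d hd => by simpa [hB] using (hDZ' d hd).2)
  have hW70 : #(L ∪ W) ≤ 70 := (card_union_le _ _).trans (by omega)
  set H : Finset V := univ \ (L ∪ W) with hH
  have hHm : ∀ v, v ∈ H ↔ v ∉ L ∪ W := fun v => by simp [hH]
  have hHc : #H + #(L ∪ W) = 2 * n - 1 := by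
    rw [card_sdiff_add_card_eq_card (subset_univ _), card_univ, hV]
  have hdegH : ∀ v ∈ H, (57 * n + 99) / 100 - 70 ≤ degIn G H v := by
    intro v hv
    have e1 := hLm v (by have := (hHm v).1 hv; simp at this; exact this.1)
    have e2 := degIn_sdiff_add G (L ∪ W) v
    rw [← hH] at e2
    omega
  by_cases hconn : ∀ X ⊆ H, X.Nonempty → (∀ x ∈ X, ∀ y ∈ H, G.Adj x y → y ∈ X) → X = H
  · obtain ⟨p, f, hp, hf⟩ := exists_longestPath G (H := H) (card_pos.1 (by omega))
    have hlong : n - 7 ≤ p := by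
      rcases hf.le_or hp hdegH hconn with e | e <;> omega
    obtain ⟨g, g1, g2, g3, g4⟩ := hf.exists_path_of_card
      (R₁ := {r ∈ univ \ L | ∀ d ∈ D₁, ¬ G.Adj d r})
      (R₂ := {r ∈ univ \ L | ∀ d ∈ D₂, ¬ G.Adj d r})
      (U := 37 ^ 8 * (2 * n - 1) / 50 ^ 8) (q := n - 7) (by omega) hlong hdegH
      (by rw [Nat.le_div_iff_mul_le (by norm_num)]; linarith)
      (by rw [Nat.le_div_iff_mul_le (by norm_num)]; linarith) (by norm_num; omega)
    have hg : ∀ i < n - 7, g i ∉ L ∧ g i ∉ W := fun i hi => by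
      simpa using (hHm _).1 (g2 i hi)
    simp only [mem_filter, mem_sdiff, mem_univ, true_and, not_and, not_forall, not_not] at g3 g4
    obtain ⟨d, hd, hdg⟩ := g3 (hg _ (by omega)).1
    obtain ⟨e, he, heg⟩ := g4 (hg _ (by omega)).1
    have hd' : d ∈ D₁ ∪ D₂ := mem_union_left _ hd
    have he' : e ∈ D₁ ∪ D₂ := mem_union_right _ he
    obtain ⟨l1, l2⟩ := w5 d hd' e he' fun h => Finset.disjoint_left.1 hD hd (h ▸ he)
    have hl := pathOn_list _ h l1 l2
    have hlW : ∀ i < 7, [e, s e, x e, h, x d, s d, d].getD i h ∈ W := by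
      intro i hi
      interval_cases i
      exacts [w3 he', (w4 e he').1, (w4 e he').2, w2, (w4 d hd').2, (w4 d hd').1, w3 hd']
    have hc := g1.append_cycleOn hl (fun i hi j hj h => (hg i hi).2 (h ▸ hlW j hj)) (by omega)
      (by simp) heg.symm hdg
    have hlen : n - 7 + [e, s e, x e, h, x d, s d, d].length = n := by
      simp only [List.length_cons, List.length_nil]; omega
    rw [hlen] at hc
    exact hc.hasCycleLength (by omega)
  · push Not at hconn
    obtain ⟨X, hXH, hX0, hX, hne⟩ := hconn
    refine hasCycleLength_of_closed_pair hn hV hpair hz (W := L ∪ W) (X := X) (Y := H \ X) hW70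
      disjoint_sdiff ?_ ?_ (fun v => ?_) hX0 ?_ (fun a ha b hb hab => ?_) (fun v hv => ?_)
    · rw [Finset.disjoint_left]
      exact fun v hv hvX => (hHm v).1 (hXH hvX) hv
    · rw [Finset.disjoint_left]
      exact fun v hv hvX => (hHm v).1 (mem_sdiff.1 hvX).1 hv
    · rw [mem_sdiff, hHm]
      tauto
    · rw [sdiff_nonempty]
      exact fun h => hne (hXH.antisymm h)
    · rw [mem_sdiff] at hb
      exact hb.2 (hX a ha b hb.1 hab)
    · exact hLm v fun h => hv (mem_union_left _ h)

/-- A partition of the vertices into `A` and `B` together with two sets `E` and `F` of about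
half of the vertices such that `A` sends few edges to `E` and many to `F`, while `B` sends few
edges to `F` and many to `E`; the vertex `z` is exempt from the lower bounds. -/
structure Split (G : SimpleGraph V) (n : ℕ) (z : V) (E F A B : Finset V) : Prop where
  disj : Disjoint A B
  cov : ∀ v, v ∈ A ∨ v ∈ B
  le_card_left : n ≤ #E + 66
  card_left_le : #E ≤ n + 66
  le_card_right : n ≤ #F + 66
  card_right_le : #F ≤ n + 66
  low_left : ∀ v ∈ A, degIn G E v ≤ 226
  low_right : ∀ v ∈ B, degIn G F v ≤ 226
  high_left : ∀ v ∈ A, v ≠ z → n ≤ 2 * (degIn G F v + 227)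
  high_right : ∀ v ∈ B, v ≠ z → n ≤ 2 * (degIn G E v + 227)
  miss_left : ∀ u ∈ A, ∀ v ∈ A, u ≠ v → #{w ∈ F | ¬ G.Adj u w ∧ ¬ G.Adj v w} ≤ 388
  miss_right : ∀ u ∈ B, ∀ v ∈ B, u ≠ v → #{w ∈ E | ¬ G.Adj u w ∧ ¬ G.Adj v w} ≤ 388

lemma Split.symm {G : SimpleGraph V} {n : ℕ} {z : V} {E F A B : Finset V}
    (s : Split G n z E F A B) : Split G n z F E B A :=
  ⟨s.disj.symm, fun v => (s.cov v).symm, s.le_card_right, s.card_right_le, s.le_card_left,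
    s.card_left_le, s.low_right, s.low_left, s.high_right, s.high_left, s.miss_right, s.miss_left⟩

lemma Split.card_inter {G : SimpleGraph V} {n : ℕ} {z : V} {E F A B : Finset V}
    (s : Split G n z E F A B) (S : Finset V) : #(A ∩ S) + #(B ∩ S) = #S := by
  rw [← card_union_of_disjoint (disjoint_of_subset_left inter_subset_left
    (disjoint_of_subset_right inter_subset_left s.disj)), ← union_inter_distrib_right]
  congr 1
  ext v
  simp only [mem_inter, mem_union, and_iff_right_iff_imp]
  exact fun _ => s.cov v

lemma card_le_of_pair_miss_twice {G : SimpleGraph V} {C D F : Finset V} {n : ℕ} (hn : 4516 ≤ n)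
    (hDF : D ⊆ F)
    (hpair : ∀ a ∈ C, ∀ b ∈ C, a ≠ b → #{w ∈ F | ¬ G.Adj a w ∧ ¬ G.Adj b w} ≤ 388)
    (hd : ∀ d ∈ D, degIn G C d ≤ 226) (hC : 57 * n ≤ 100 * (#C + 340))
    (hD : 100 * #D ≤ 43 * n + 40600) : #D ≤ 908 ∧ (n ≤ #C + 974 → #D ≤ 508) := by
  have hp : ∀ a ∈ C, ∀ b ∈ C, a ≠ b → #{w ∈ D | ¬ G.Adj a w ∧ ¬ G.Adj b w} ≤ 388 :=
    fun a ha b hb hab => (card_le_card (filter_subset_filter _ hDF)).trans (hpair a ha b hb hab)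
  have h1 := card_le_of_pair_miss (y := 260) hp hd (by omega)
  exact ⟨h1, fun h => card_le_of_pair_miss (y := 60) hp hd (by omega)⟩

lemma Split.not_same {G : SimpleGraph V} {n : ℕ} (hn : 4516 ≤ n) {z : V} {E F A B : Finset V}
    (s : Split G n z E F A B) (h1 : 57 * n ≤ 100 * (#(A ∩ F) + 340))
    (h2 : 57 * n ≤ 100 * (#(B ∩ F) + 340)) : False := by
  have e1 := s.card_inter F
  have e2 := s.card_right_le
  have := (card_le_of_pair_miss_twice hn (C := A ∩ F) (D := B ∩ F) inter_subset_right
    (fun a ha b hb => s.miss_left a (mem_inter.1 ha).1 b (mem_inter.1 hb).1)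
    (fun d hd => (degIn_mono G inter_subset_right d).trans (s.low_right d (mem_inter.1 hd).1))
    h1 (by omega)).1
  omega

lemma Split.exists_core {G : SimpleGraph V} {n : ℕ} (hn : 4516 ≤ n) (hne : Even n) {z : V}
    {E F A B : Finset V}
    (s : Split G n z E F A B) (h1 : 57 * n ≤ 100 * (#(A ∩ F) + 340)) :
    ∃ A₀ ⊆ A.erase z, n ≤ #A₀ + 600 ∧ (∀ a ∈ A₀, n + 10 ≤ 2 * degIn G A₀ a) ∧
      (∀ a ∈ A₀, 2 * #A₀ ≤ n + 2 * degIn G A₀ a) ∧ ∀ a ∈ A.erase z, 700 ≤ degIn G A₀ a := by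
  obtain ⟨k, rfl⟩ := hne
  have e1 := s.card_inter F
  have e2 := s.card_right_le
  have e3 := s.le_card_right
  obtain ⟨e4, e5⟩ := card_le_of_pair_miss_twice hn (C := A ∩ F) (D := B ∩ F) inter_subset_right
    (fun a ha b hb => s.miss_left a (mem_inter.1 ha).1 b (mem_inter.1 hb).1)
    (fun d hd => (degIn_mono G inter_subset_right d).trans (s.low_right d (mem_inter.1 hd).1))
    h1 (by omega)
  have e6 := e5 (by omega)
  set A₁ := A ∩ F with hA₁
  set bad : Finset V := {a ∈ A₁ | k - 600 ≤ #(A₁ ∩ ({w ∈ A₁ | ¬ G.Adj a w} : Finset V))} with hbad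
  have hb : #bad < 10 := by
    refine card_lt_of_johnson bad (fun a => ({w ∈ A₁ | ¬ G.Adj a w} : Finset V)) A₁ 388 (k - 600)
      10 (k + k + 66) (fun i hi j hj hij => ?_) (fun i hi => ?_) ?_ ?_
    · refine (card_le_card fun w hw => ?_).trans (s.miss_left i
        (mem_inter.1 (mem_filter.1 hi).1).1 j (mem_inter.1 (mem_filter.1 hj).1).1 hij)
      simp only [mem_inter, mem_filter, hA₁] at hw ⊢
      tauto
    · rw [hbad, mem_filter] at hi
      exact hi.2
    · omega
    · have hk : 1658 ≤ k - 600 := by omega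
      have hk' : k = k - 600 + 600 := by omega
      generalize k - 600 = t at hk hk'
      rw [hk']
      nlinarith
  have hc1 : #A₁ ≤ #((A₁ \ bad).erase z) + 10 := by
    have := pred_card_le_card_erase (s := A₁ \ bad) (a := z)
    have := le_card_sdiff bad A₁
    omega
  have hsub : (A₁ \ bad).erase z ⊆ A₁ := (erase_subset _ _).trans sdiff_subset
  have hdeg : ∀ a ∈ (A₁ \ bad).erase z,
      #((A₁ \ bad).erase z) + 1 ≤ degIn G ((A₁ \ bad).erase z) a + (k - 600) := by
    intro a ha
    have f1 := (mem_sdiff.1 (mem_of_mem_erase ha)).2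
    rw [hbad, mem_filter, not_and, not_le] at f1
    have f2 := f1 (hsub ha)
    have f3 := card_filter_add_card_filter_not (s := (A₁ \ bad).erase z) (fun w => G.Adj a w)
    have f4 : #{w ∈ (A₁ \ bad).erase z | ¬ G.Adj a w} ≤
        #(A₁ ∩ ({w ∈ A₁ | ¬ G.Adj a w} : Finset V)) := card_le_card fun w hw => by
      rw [mem_filter] at hw
      rw [mem_inter, mem_filter]
      exact ⟨hsub hw.1, hsub hw.1, hw.2⟩
    unfold degIn
    omega
  refine ⟨(A₁ \ bad).erase z, fun x hx => mem_erase.2 ⟨ne_of_mem_erase hx,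
    (mem_inter.1 (hsub hx)).1⟩, by omega, fun a ha => ?_, fun a ha => ?_, fun a ha => ?_⟩
  · have := hdeg a ha
    omega
  · have := hdeg a ha
    omega
  · have f1 := s.high_left a (mem_of_mem_erase ha) (ne_of_mem_erase ha)
    have f2 := degIn_le_sdiff_add G F (F \ (A₁ \ bad).erase z) a
    have f3 : (A₁ \ bad).erase z ⊆ F := hsub.trans inter_subset_right
    rw [Finset.sdiff_sdiff_eq_self f3, card_sdiff_of_subset f3] at f2
    omega

lemma Split.clique_case [Fintype V] {G : SimpleGraph V} {n : ℕ} (hn : 4516 ≤ n) (hne : Even n)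
    (hV : Fintype.card V = 2 * n - 1) (hpair : PairsDominate G n) {z : V} {E F A B : Finset V}
    (s : Split G n z E F A B) (h1 : 57 * n ≤ 100 * (#(A ∩ F) + 340))
    (h2 : 57 * n ≤ 100 * (#(B ∩ E) + 340)) : HasCycleLength G n := by
  obtain ⟨A₀, a1, a2, a3, a4, a5⟩ := s.exists_core hn hne h1
  obtain ⟨B₀, b1, b2, b3, b4, b5⟩ := s.symm.exists_core hn hne h2
  refine hasCycleLength_of_two_cliques hn hV hpair (z := z) (disjoint_of_subset_left
    (erase_subset _ _) (disjoint_of_subset_right (erase_subset _ _) s.disj)) (by simp) (by simp)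
    (fun v hv => ?_) a1 b1 a2 b2 a3 b3 a4 b4 a5 b5
  have := s.cov v
  simp only [mem_erase]
  tauto

lemma exists_few_bad {G : SimpleGraph V} {P Q R : Finset V} {k : ℕ} (hk : 2258 ≤ k)
    (hQ : #Q = k + 9) (hQR : Q ⊆ R)
    (hmiss : ∀ u ∈ P, ∀ v ∈ P, u ≠ v → #{w ∈ R | ¬ G.Adj u w ∧ ¬ G.Adj v w} ≤ 388) :
    #{a ∈ P | (k + 1) / 2 ≤ #(Q ∩ ({w ∈ Q | ¬ G.Adj a w} : Finset V))} < 10 := by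
  refine card_lt_of_johnson _ (fun a => ({w ∈ Q | ¬ G.Adj a w} : Finset V)) Q 388 ((k + 1) / 2)
    10 (k + 9) (fun i hi j hj hij => ?_) (fun i hi => (mem_filter.1 hi).2) hQ.le ?_
  · refine (card_le_card fun w hw => ?_).trans (hmiss i (mem_filter.1 hi).1 j (mem_filter.1 hj).1
      hij)
    simp only [mem_inter, mem_filter] at hw ⊢
    exact ⟨hQR hw.1, hw.2.1.2, hw.2.2.2⟩
  · have h1 : k ≤ 2 * ((k + 1) / 2) := by omega
    have h2 : 1129 ≤ (k + 1) / 2 := by omega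
    generalize (k + 1) / 2 = t at *
    nlinarith

lemma Split.bipartite_case [Finite V] {G : SimpleGraph V} {n : ℕ} (hn : 4516 ≤ n) (hne : Even n)
    {z : V} {E F A B : Finset V}
    (s : Split G n z E F A B) (h1 : 57 * n ≤ 100 * (#(A ∩ E) + 340))
    (h2 : 57 * n ≤ 100 * (#(B ∩ F) + 340)) : HasCycleLength G n := by
  obtain ⟨k, rfl⟩ := hne
  have hbig : ∀ {E F A B : Finset V}, Split G (k + k) z E F A B →
      57 * (k + k) ≤ 100 * (#(A ∩ E) + 340) → 57 * (k + k) ≤ 100 * (#(B ∩ F) + 340) →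
      k + 9 ≤ #(B ∩ F) := by
    intro E F A B s h1 h2
    have e1 := s.card_inter F
    have e2 := s.card_right_le
    have e3 := s.le_card_right
    have := (card_le_of_pair_miss_twice hn (C := A ∩ E) (D := A ∩ F) inter_subset_right
      (fun a ha b hb => s.miss_left a (mem_inter.1 ha).1 b (mem_inter.1 hb).1)
      (fun d hd => (degIn_mono G inter_subset_right d).trans (s.low_left d (mem_inter.1 hd).1))
      h1 (by omega)).1
    omega
  obtain ⟨P, hP, hPc⟩ := exists_subset_card_eq (hbig s.symm h2 h1)
  obtain ⟨Q, hQ, hQc⟩ := exists_subset_card_eq (hbig s h1 h2)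
  have hbP := exists_few_bad (G := G) (P := P) (by omega) hQc (hQ.trans inter_subset_right)
    fun u hu v hv => s.miss_left u (mem_inter.1 (hP hu)).1 v (mem_inter.1 (hP hv)).1
  have hbQ := exists_few_bad (G := G) (P := Q) (by omega) hPc (hP.trans inter_subset_right)
    fun u hu v hv => s.miss_right u (mem_inter.1 (hQ hu)).1 v (mem_inter.1 (hQ hv)).1
  have hgood : ∀ {P Q : Finset V}, #P = k + 9 →
      #{a ∈ P | (k + 1) / 2 ≤ #(Q ∩ ({w ∈ Q | ¬ G.Adj a w} : Finset V))} < 10 →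
      ∃ P' ⊆ P, #P' = k ∧ ∀ a ∈ P', #{w ∈ Q | ¬ G.Adj a w} < (k + 1) / 2 := by
    intro P Q hPc hb
    have := card_filter_add_card_filter_not (s := P)
      (fun a => (k + 1) / 2 ≤ #(Q ∩ ({w ∈ Q | ¬ G.Adj a w} : Finset V)))
    obtain ⟨P', h1, h2⟩ := exists_subset_card_eq (n := k)
      (s := {a ∈ P | ¬ (k + 1) / 2 ≤ #(Q ∩ ({w ∈ Q | ¬ G.Adj a w} : Finset V))}) (by omega)
    refine ⟨P', h1.trans (filter_subset _ _), h2, fun a ha => ?_⟩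
    have := (mem_filter.1 (h1 ha)).2
    rwa [inter_eq_right.2 (filter_subset _ _), not_le] at this
  obtain ⟨P', p1, p2, p3⟩ := hgood hPc hbP
  obtain ⟨Q', q1, q2, q3⟩ := hgood hQc hbQ
  have hdeg : ∀ {Q Q' : Finset V} (a : V), Q' ⊆ Q → #Q' = k →
      #{w ∈ Q | ¬ G.Adj a w} < (k + 1) / 2 → k + 1 ≤ 2 * degIn G Q' a := by
    intro Q Q' a hQ hQc h
    have f1 := card_filter_add_card_filter_not (s := Q') (fun w => G.Adj a w)
    have f2 := card_le_card (filter_subset_filter (fun w => ¬ G.Adj a w) hQ)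
    unfold degIn
    omega
  have hPQ : Disjoint P' Q' := disjoint_of_subset_left ((p1.trans hP).trans inter_subset_left)
    (disjoint_of_subset_right ((q1.trans hQ).trans inter_subset_left) s.disj)
  have hs := spans_bipartite hPQ (p2.trans q2.symm) (by omega)
    (fun v hv => p2 ▸ hdeg v q1 q2 (p3 v hv)) (fun v hv => p2 ▸ hdeg v p1 p2 (q3 v hv))
  have hc : #(P' ∪ Q') = k + k := by rw [card_union_of_disjoint hPQ, p2, q2]
  exact hc ▸ hs.hasCycleLength (by omega)

lemma card_few_bad_nbrs {G : SimpleGraph V} {B E : Finset V} {c : ℕ} (hB : 226 ≤ #B)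
    (hpair : ∀ g ∈ B, ∀ g' ∈ B, g ≠ g' → #{w ∈ E | ¬ G.Adj g w ∧ ¬ G.Adj g' w} ≤ c) :
    37056 * #{w ∈ E | degIn G B w ≤ 33} ≤ 50850 * c := by
  obtain ⟨I, hI, hIc⟩ := exists_subset_card_eq hB
  have h1 := sum_mult_sq_le I (fun g => ({w ∈ E | ¬ G.Adj g w} : Finset V))
    {w ∈ E | degIn G B w ≤ 33} c fun i hi j hj hij => by
      refine (card_le_card fun w hw => ?_).trans (hpair i (hI hi) j (hI hj) hij)
      simp only [mem_inter, mem_filter] at hw ⊢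
      tauto
  have h2 : ∀ w ∈ ({w ∈ E | degIn G B w ≤ 33} : Finset V),
      37056 + #{i ∈ I | w ∈ ({w ∈ E | ¬ G.Adj i w} : Finset V)} ≤
        #{i ∈ I | w ∈ ({w ∈ E | ¬ G.Adj i w} : Finset V)} ^ 2 := by
    intro w hw
    rw [mem_filter] at hw
    have e1 := card_filter_add_card_filter_not (s := I) (fun i => G.Adj w i)
    have e2 : #{i ∈ I | ¬ G.Adj w i} ≤ #{i ∈ I | w ∈ ({w ∈ E | ¬ G.Adj i w} : Finset V)} :=
      card_le_card fun i hi => by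
        simp only [mem_filter] at hi ⊢
        exact ⟨hi.1, hw.1, fun h => hi.2 h.symm⟩
    have e3 := degIn_mono G hI w
    have e4 : 193 ≤ #{i ∈ I | w ∈ ({w ∈ E | ¬ G.Adj i w} : Finset V)} := by
      unfold degIn at *
      omega
    nlinarith
  have h3 := sum_le_sum h2
  rw [sum_add_distrib, sum_const, smul_eq_mul, mul_comm] at h3
  rw [hIc] at h1
  omega

lemma card_le_one_of_few_common {G : SimpleGraph V} [Fintype V] {B E : Finset V} {c : ℕ} {v : V}
    (hpair : ∀ g ∈ B, ∀ g' ∈ B, g ≠ g' → #{w ∈ E | ¬ G.Adj g w ∧ ¬ G.Adj g' w} ≤ c)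
    (hv : c + 95 ≤ degIn G E v) : #{u ∈ B | ¬ 48 ≤ #{w | G.Adj u w ∧ G.Adj v w}} ≤ 1 := by
  rw [card_le_one]
  intro a ha b hb
  rw [mem_filter] at ha hb
  by_contra hab
  have h1 := hpair a ha.1 b hb.1 hab
  have h2 : degIn G E v ≤ #({w ∈ E | ¬ G.Adj a w ∧ ¬ G.Adj b w} ∪
      (({w | G.Adj a w ∧ G.Adj v w} : Finset V) ∪ ({w | G.Adj b w ∧ G.Adj v w} : Finset V))) :=
    card_le_card fun w hw => by
      simp only [mem_union, mem_filter, mem_univ, true_and] at hw ⊢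
      tauto
  have h3 := card_union_le {w ∈ E | ¬ G.Adj a w ∧ ¬ G.Adj b w}
    (({w | G.Adj a w ∧ G.Adj v w} : Finset V) ∪ ({w | G.Adj b w ∧ G.Adj v w} : Finset V))
  have h4 := card_union_le ({w | G.Adj a w ∧ G.Adj v w} : Finset V) {w | G.Adj b w ∧ G.Adj v w}
  omega

lemma degIn_le_of_few_common {G : SimpleGraph V} [Fintype V] {B E : Finset V} {c : ℕ} {v w : V}
    (hpair : ∀ g ∈ B, ∀ g' ∈ B, g ≠ g' → #{w ∈ E | ¬ G.Adj g w ∧ ¬ G.Adj g' w} ≤ c)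
    (hv : c + 95 ≤ degIn G E v)
    (hw : degIn G {u | 48 ≤ #{w | G.Adj u w ∧ G.Adj v w}} w < 33) : degIn G B w ≤ 33 := by
  have h1 := card_le_one_of_few_common hpair hv
  have h2 := degIn_le_sdiff_add G B {u ∈ B | ¬ 48 ≤ #{w | G.Adj u w ∧ G.Adj v w}} w
  have h3 : degIn G (B \ {u ∈ B | ¬ 48 ≤ #{w | G.Adj u w ∧ G.Adj v w}}) w ≤
      degIn G {u | 48 ≤ #{w | G.Adj u w ∧ G.Adj v w}} w := degIn_mono G (fun u hu => by
    simp only [mem_sdiff, mem_filter, mem_univ, true_and] at hu ⊢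
    tauto) w
  omega

lemma miss_add_le_of_degIn {G : SimpleGraph V} [Fintype V] {n a : ℕ} (hpair : PairsDominate G n)
    {E : Finset V} {u v : V} (huv : u ≠ v) (hu : degIn G Eᶜ u ≤ a) (hv : degIn G Eᶜ v ≤ a) :
    #{w ∈ E | ¬ G.Adj u w ∧ ¬ G.Adj v w} + n ≤ #E + (a + a + 2) := by
  have h1 := hpair u v huv
  have h2 : #{w | w = u ∨ w = v ∨ G.Adj u w ∨ G.Adj v w} ≤
      #({u, v} ∪ (({w ∈ Eᶜ | G.Adj u w} ∪ {w ∈ Eᶜ | G.Adj v w}) ∪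
        {w ∈ E | ¬ (¬ G.Adj u w ∧ ¬ G.Adj v w)})) := card_le_card fun w hw => by
    simp only [mem_union, mem_filter, mem_univ, true_and, mem_insert, mem_singleton,
      mem_compl] at hw ⊢
    tauto
  have h3 := card_union_le {u, v} (({w ∈ Eᶜ | G.Adj u w} ∪ {w ∈ Eᶜ | G.Adj v w}) ∪
    {w ∈ E | ¬ (¬ G.Adj u w ∧ ¬ G.Adj v w)})
  have h4 := card_union_le ({w ∈ Eᶜ | G.Adj u w} ∪ {w ∈ Eᶜ | G.Adj v w})
    {w ∈ E | ¬ (¬ G.Adj u w ∧ ¬ G.Adj v w)}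
  have h5 := card_union_le {w ∈ Eᶜ | G.Adj u w} {w ∈ Eᶜ | G.Adj v w}
  have h6 := card_filter_add_card_filter_not (s := E) (fun w => ¬ G.Adj u w ∧ ¬ G.Adj v w)
  have h7 := card_pair huv
  unfold degIn at hu hv
  omega

lemma card_inter_le_one {G : SimpleGraph V} [Fintype V] {n : ℕ} (hn : 4516 ≤ n)
    (hV : Fintype.card V = 2 * n - 1) (hpair : PairsDominate G n) {g h : V}
    (hg : 57 * n ≤ 100 * degIn G univ g) (hh : 57 * n ≤ 100 * degIn G univ h)
    (hgh : #{w | G.Adj g w ∧ G.Adj h w} < 48) :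
    #(({v | #{w | G.Adj v w ∧ G.Adj h w} < 48} : Finset V) ∩
      ({v | #{w | G.Adj v w ∧ G.Adj g w} < 48} : Finset V)) ≤ 1 := by
  rw [card_le_one]
  intro u hu v hv
  simp only [mem_inter, mem_filter, mem_univ, true_and] at hu hv
  by_contra huv
  have h1 := hpair u v huv
  unfold degIn at hg hh
  have h2 := card_union_add_card_inter ({w | G.Adj g w} : Finset V) {w | G.Adj h w}
  rw [← filter_and] at h2
  have h3 := card_union_add_card_inter ({w | w = u ∨ w = v ∨ G.Adj u w ∨ G.Adj v w} : Finset V)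
    (({w | G.Adj g w} : Finset V) ∪ ({w | G.Adj h w} : Finset V))
  have h4 := card_le_univ (({w | w = u ∨ w = v ∨ G.Adj u w ∨ G.Adj v w} : Finset V) ∪
    (({w | G.Adj g w} : Finset V) ∪ ({w | G.Adj h w} : Finset V)))
  have h5 : #(({w | w = u ∨ w = v ∨ G.Adj u w ∨ G.Adj v w} : Finset V) ∩
      (({w | G.Adj g w} : Finset V) ∪ ({w | G.Adj h w} : Finset V))) ≤
      #({u, v} ∪ ((({w | G.Adj u w ∧ G.Adj h w} : Finset V) ∪ ({w | G.Adj u w ∧ G.Adj g w} : Finset V)) ∪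
        (({w | G.Adj v w ∧ G.Adj h w} : Finset V) ∪ ({w | G.Adj v w ∧ G.Adj g w} : Finset V)))) :=
    card_le_card fun w hw => by
      simp only [mem_inter, mem_union, mem_filter, mem_univ, true_and, mem_insert,
        mem_singleton] at hw ⊢
      tauto
  have h6 := card_union_le {u, v}
    ((({w | G.Adj u w ∧ G.Adj h w} : Finset V) ∪ ({w | G.Adj u w ∧ G.Adj g w} : Finset V)) ∪
        (({w | G.Adj v w ∧ G.Adj h w} : Finset V) ∪ ({w | G.Adj v w ∧ G.Adj g w} : Finset V)))
  have h7 := card_union_le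
    (({w | G.Adj u w ∧ G.Adj h w} : Finset V) ∪ ({w | G.Adj u w ∧ G.Adj g w} : Finset V))
    (({w | G.Adj v w ∧ G.Adj h w} : Finset V) ∪ ({w | G.Adj v w ∧ G.Adj g w} : Finset V))
  have h8 := card_union_le ({w | G.Adj u w ∧ G.Adj h w} : Finset V) {w | G.Adj u w ∧ G.Adj g w}
  have h9 := card_union_le ({w | G.Adj v w ∧ G.Adj h w} : Finset V) {w | G.Adj v w ∧ G.Adj g w}
  have h10 := card_pair huv
  omega

lemma Split.card_nbrs_right {G : SimpleGraph V} [Fintype V] {n : ℕ} (hn : 4516 ≤ n) {z : V}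
    {E F A B : Finset V} (s : Split G n z E F A B) {h : V}
    (hE : ∀ e ∈ E, #{w | G.Adj e w ∧ G.Adj h w} < 48) : degIn G B h ≤ 111 := by
  set D := ({w ∈ B | G.Adj h w} : Finset V).erase z with hD
  have h1 : ∑ v ∈ D, degIn G E v = ∑ e ∈ E, degIn G D e := sum_degIn_comm G D E
  have h2 : ∑ e ∈ E, degIn G D e ≤ #E * 47 := by
    rw [← smul_eq_mul]
    refine sum_le_card_nsmul _ _ _ fun e he => ?_
    have := hE e he
    refine (card_le_card fun w hw => ?_).trans (Nat.le_of_lt_succ this)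
    simp only [hD, mem_filter, mem_erase, mem_univ, true_and] at hw ⊢
    exact ⟨hw.2, hw.1.2.2⟩
  have h3 : #D * (n - 454) ≤ 2 * ∑ v ∈ D, degIn G E v := by
    rw [mul_sum, ← smul_eq_mul]
    refine card_nsmul_le_sum _ _ _ fun v hv => ?_
    have := s.high_right v (mem_filter.1 (mem_of_mem_erase hv)).1 (ne_of_mem_erase hv)
    omega
  have h4 := s.card_left_le
  have h5 : degIn G B h ≤ #D + 1 := by
    have := pred_card_le_card_erase (s := ({w ∈ B | G.Adj h w} : Finset V)) (a := z)
    rw [← hD] at this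
    unfold degIn
    omega
  by_contra! h6
  obtain ⟨t, rfl⟩ : ∃ t, n = t + 454 := ⟨n - 454, by omega⟩
  rw [Nat.add_sub_cancel] at h3
  have h7 : 111 * t ≤ #D * t := Nat.mul_le_mul_right t (by omega)
  omega

lemma Split.card_inter_large {G : SimpleGraph V} [Fintype V] {n : ℕ} (hn : 4516 ≤ n) {z : V}
    {E F A B : Finset V} (s : Split G n z E F A B) {h : V}
    (hE : ∀ e ∈ E, #{w | G.Adj e w ∧ G.Adj h w} < 48) (hh : 57 * n ≤ 100 * degIn G univ h)
    {K : Finset V} (hK : degIn G Kᶜ h ≤ 226) : 57 * n ≤ 100 * (#(A ∩ K) + 340) := by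
  have h1 := s.card_nbrs_right hn hE
  have h2 : degIn G univ h ≤ degIn G (B ∪ (Kᶜ ∪ (A ∩ K))) h := degIn_mono G (fun v _ => by
    have := s.cov v
    simp only [mem_union, mem_compl, mem_inter]
    tauto) h
  have h3 := degIn_union_le G B (Kᶜ ∪ (A ∩ K)) h
  have h4 := degIn_union_le G Kᶜ (A ∩ K) h
  have h5 := degIn_le_card G (A ∩ K) h
  omega

theorem hasCycleLength_of_many_bad [Fintype V] {G : SimpleGraph V} {n : ℕ} (hn : 4516 ≤ n)
    (hne : Even n) (hV : Fintype.card V = 2 * n - 1) (hpair : PairsDominate G n) {z : V}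
    (hz : ∀ v, v ≠ z → n ≤ 2 * (degIn G univ v + 1))
    (hL : #{v | ¬ 57 * n ≤ 100 * degIn G univ v} ≤ 21)
    (hB : ∀ h, 226 ≤ #{v | degIn G {v | 48 ≤ #{w | G.Adj v w ∧ G.Adj h w}} v < 33}) :
    HasCycleLength G n := by
  have key : ∀ h, ∀ g ∈ ({v | degIn G {v | 48 ≤ #{w | G.Adj v w ∧ G.Adj h w}} v < 33} : Finset V),
      ∀ g' ∈ ({v | degIn G {v | 48 ≤ #{w | G.Adj v w ∧ G.Adj h w}} v < 33} : Finset V), g ≠ g' →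
      #{w ∈ ({v | #{w | G.Adj v w ∧ G.Adj h w} < 48} : Finset V) |
        ¬ G.Adj g w ∧ ¬ G.Adj g' w} + n ≤ #{v | #{w | G.Adj v w ∧ G.Adj h w} < 48} + 66 := by
    intro h g hg g' hg' hgg'
    rw [mem_filter] at hg hg'
    have : ({v | #{w | G.Adj v w ∧ G.Adj h w} < 48} : Finset V)ᶜ =
        ({v | 48 ≤ #{w | G.Adj v w ∧ G.Adj h w}} : Finset V) := by
      ext v
      simp
    refine miss_add_le_of_degIn hpair hgg' (a := 32) ?_ ?_ <;> rw [this] <;> omega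
  have hU : ∀ h, n ≤ #{v | #{w | G.Adj v w ∧ G.Adj h w} < 48} + 66 := by
    intro h
    obtain ⟨a, ha, b, hb, hab⟩ := one_lt_card.1 (lt_of_lt_of_le (by norm_num) (hB h))
    have := key h a ha b hb hab
    omega
  obtain ⟨h, -, hh⟩ := exists_mem_notMem_of_card_lt_card
    (s := ({v | ¬ 57 * n ≤ 100 * degIn G univ v} : Finset V)) (t := univ) (by
      rw [card_univ]
      omega)
  obtain ⟨g, hgU, hg⟩ := exists_mem_notMem_of_card_lt_card
    (s := ({v | ¬ 57 * n ≤ 100 * degIn G univ v} : Finset V))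
    (t := ({v | #{w | G.Adj v w ∧ G.Adj h w} < 48} : Finset V)) (by
      have := hU h
      omega)
  simp only [mem_filter, mem_univ, true_and, not_not] at hh hg hgU
  have hEF := card_inter_le_one hn hV hpair hg hh hgU
  have hE : ∀ e ∈ ({v | #{w | G.Adj v w ∧ G.Adj h w} < 48} : Finset V),
      #{w | G.Adj e w ∧ G.Adj h w} < 48 := fun e he => (mem_filter.1 he).2
  have hF : ∀ e ∈ ({v | #{w | G.Adj v w ∧ G.Adj g w} < 48} : Finset V),
      #{w | G.Adj e w ∧ G.Adj g w} < 48 := fun e he => (mem_filter.1 he).2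
  have kE := key h
  have kF := key g
  have hEn := hU h
  have hFn := hU g
  have hB1 := hB h
  have hB2 := hB g
  generalize ({v | #{w | G.Adj v w ∧ G.Adj h w} < 48} : Finset V) = E at *
  generalize ({v | #{w | G.Adj v w ∧ G.Adj g w} < 48} : Finset V) = F at *
  generalize ({v | degIn G {v | 48 ≤ #{w | G.Adj v w ∧ G.Adj h w}} v < 33} : Finset V) = P at *
  generalize ({v | degIn G {v | 48 ≤ #{w | G.Adj v w ∧ G.Adj g w}} v < 33} : Finset V) = Q at *
  obtain ⟨c, hc⟩ : ∃ c, #E + 66 = n + c := ⟨#E + 66 - n, by omega⟩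
  obtain ⟨d, hd⟩ : ∃ d, #F + 66 = n + d := ⟨#F + 66 - n, by omega⟩
  replace kE : ∀ a ∈ P, ∀ b ∈ P, a ≠ b → #{w ∈ E | ¬ G.Adj a w ∧ ¬ G.Adj b w} ≤ c :=
    fun a ha b hb hab => by
      have := kE a ha b hb hab
      omega
  replace kF : ∀ a ∈ Q, ∀ b ∈ Q, a ≠ b → #{w ∈ F | ¬ G.Adj a w ∧ ¬ G.Adj b w} ≤ d :=
    fun a ha b hb hab => by
      have := kF a ha b hb hab
      omega
  have hO : c + d + #(E ∪ F)ᶜ ≤ 132 := by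
    have h1 := card_union_add_card_inter E F
    have h2 := card_compl_add_card (E ∪ F)
    omega
  have hsplit : ∀ v, degIn G E v ≤ c + 94 ∨ degIn G F v ≤ d + 94 := by
    intro v
    by_contra! hv
    have h1 := card_few_bad_nbrs hB1 kE
    have h2 := card_few_bad_nbrs hB2 kF
    have h3 := hB v
    have h4 : #{u | degIn G {u | 48 ≤ #{w | G.Adj u w ∧ G.Adj v w}} u < 33} ≤
        #((E ∪ F)ᶜ ∪ ({w ∈ E | degIn G P w ≤ 33} ∪ {w ∈ F | degIn G Q w ≤ 33})) :=
      card_le_card fun w hw => by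
        rw [mem_filter] at hw
        have e1 := degIn_le_of_few_common kE hv.1 hw.2
        have e2 := degIn_le_of_few_common kF hv.2 hw.2
        simp only [mem_union, mem_compl, mem_filter]
        tauto
    have h5 := card_union_le (E ∪ F)ᶜ
      ({w ∈ E | degIn G P w ≤ 33} ∪ {w ∈ F | degIn G Q w ≤ 33})
    have h6 := card_union_le {w ∈ E | degIn G P w ≤ 33} {w ∈ F | degIn G Q w ≤ 33}
    omega
  have hout : ∀ {E F : Finset V} (v : V), degIn G Fᶜ v ≤ degIn G E v + #(E ∪ F)ᶜ := by
    intro E F v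
    have h1 := degIn_mono G (K := Fᶜ) (L := E ∪ (E ∪ F)ᶜ) (fun w hw => by
      simp only [mem_union, mem_compl] at hw ⊢
      tauto) v
    have h2 := degIn_union_le G E (E ∪ F)ᶜ v
    have h3 := degIn_le_card G (E ∪ F)ᶜ v
    omega
  have hA : ∀ v ∈ ({v | degIn G E v ≤ c + 94} : Finset V), degIn G E v ≤ c + 94 :=
    fun v hv => (mem_filter.1 hv).2
  have hA' : ∀ v ∈ ({v | ¬ degIn G E v ≤ c + 94} : Finset V), degIn G F v ≤ d + 94 :=
    fun v hv => (hsplit v).resolve_left (mem_filter.1 hv).2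
  have hcov : ∀ v, v ∈ ({v | degIn G E v ≤ c + 94} : Finset V) ∨
      v ∈ ({v | ¬ degIn G E v ≤ c + 94} : Finset V) := fun v => by
    simp only [mem_filter, mem_univ, true_and]
    exact em _
  have hdisj := disjoint_filter_filter_not univ univ (fun v => degIn G E v ≤ c + 94)
  generalize ({v | degIn G E v ≤ c + 94} : Finset V) = A at *
  generalize ({v | ¬ degIn G E v ≤ c + 94} : Finset V) = B at *
  have hoA : ∀ v ∈ A, degIn G Fᶜ v ≤ c + 94 + #(E ∪ F)ᶜ := fun v hv =>
    (hout v).trans (Nat.add_le_add_right (hA v hv) _)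
  have hoB : ∀ v ∈ B, degIn G Eᶜ v ≤ d + 94 + #(E ∪ F)ᶜ := fun v hv => by
    have := hout (E := F) (F := E) v
    rw [union_comm F E] at this
    exact this.trans (Nat.add_le_add_right (hA' v hv) _)
  have hsum : ∀ (K : Finset V) v, degIn G univ v ≤ degIn G K v + degIn G Kᶜ v := fun K v => by
    rw [← union_compl K]
    exact degIn_union_le G K Kᶜ v
  have s : Split G n z E F A B :=
    { disj := hdisj
      cov := hcov
      le_card_left := by omega
      card_left_le := by omega
      le_card_right := by omega
      card_right_le := by omega
      low_left := fun v hv => (hA v hv).trans (by omega)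
      low_right := fun v hv => (hA' v hv).trans (by omega)
      high_left := fun v hv hvz => by
        have h1 := hz v hvz
        have h2 := hsum F v
        have h3 := hoA v hv
        omega
      high_right := fun v hv hvz => by
        have h1 := hz v hvz
        have h2 := hsum E v
        have h3 := hoB v hv
        omega
      miss_left := fun u hu v hv huv => by
        have := miss_add_le_of_degIn hpair huv (hoA u hu) (hoA v hv)
        omega
      miss_right := fun u hu v hv huv => by
        have := miss_add_le_of_degIn hpair huv (hoB u hu) (hoB v hv)
        omega }
  rcases hcov h with h1 | h1 <;> rcases hcov g with h2 | h2
  · exact (s.not_same hn (s.card_inter_large hn hE hh ((hoA h h1).trans (by omega)))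
      (s.symm.card_inter_large hn hF hg ((hoA g h2).trans (by omega)))).elim
  · exact s.clique_case hn hne hV hpair
      (s.card_inter_large hn hE hh ((hoA h h1).trans (by omega)))
      (s.symm.card_inter_large hn hF hg ((hoB g h2).trans (by omega)))
  · exact s.bipartite_case hn hne
      (s.card_inter_large hn hE hh ((hoB h h1).trans (by omega)))
      (s.symm.card_inter_large hn hF hg ((hoA g h2).trans (by omega)))
  · exact (s.symm.not_same hn (s.symm.card_inter_large hn hF hg ((hoB g h2).trans (by omega)))
      (s.card_inter_large hn hE hh ((hoB h h1).trans (by omega)))).elim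

lemma contains_of_card_common [Fintype V] {Γ : SimpleGraph V} {n : ℕ} {u v : V} (huv : u ≠ v)
    (h : n ≤ #{w | Γ.Adj u w ∧ Γ.Adj v w}) :
    Contains Γ (completeBipartiteGraph (Fin 2) (Fin n)) := by
  obtain ⟨e⟩ : Nonempty (Fin n ↪ ({w | Γ.Adj u w ∧ Γ.Adj v w} : Finset V)) :=
    Function.Embedding.nonempty_of_card_le (by
      rw [Fintype.card_fin, Fintype.card_coe]
      exact h)
  have he : ∀ j, Γ.Adj u (e j) ∧ Γ.Adj v (e j) := fun j => (mem_filter.1 (e j).2).2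
  have hi : ∀ (i : Fin 2) (j : Fin n), Γ.Adj (if i = 0 then u else v) (e j) := by
    intro i j
    split_ifs
    exacts [(he j).1, (he j).2]
  refine ⟨⟨Sum.elim (fun i => if i = 0 then u else v) fun j => e j, ?_⟩, ?_⟩
  · rintro (a | a) (b | b) hab
    · simp at hab
    · exact hi a b
    · exact (hi b a).symm
    · simp at hab
  · rintro (a | a) (b | b) hab
    · congr 1
      change (if a = 0 then u else v) = (if b = 0 then u else v) at hab
      split_ifs at hab <;> first | omega | exact absurd hab huv | exact absurd hab.symm huv
    · exact absurd hab (hi a b).ne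
    · exact absurd hab.symm (hi b a).ne
    · congr 1
      exact e.injective (Subtype.ext hab)

lemma pairsDominate_compl [Fintype V] {Γ : SimpleGraph V} {n : ℕ}
    (hV : Fintype.card V = 2 * n - 1)
    (h : ¬ Contains Γ (completeBipartiteGraph (Fin 2) (Fin n))) : PairsDominate Γᶜ n := by
  intro u v huv
  by_contra! hlt
  generalize hG : Γᶜ = G at hlt
  refine h (contains_of_card_common huv ?_)
  have h1 := card_filter_add_card_filter_not (s := (univ : Finset V))
    (fun w => w = u ∨ w = v ∨ G.Adj u w ∨ G.Adj v w)
  rw [card_univ] at h1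
  have h2 : #{w | ¬ (w = u ∨ w = v ∨ G.Adj u w ∨ G.Adj v w)} ≤
      #{w | Γ.Adj u w ∧ Γ.Adj v w} := card_le_card fun w hw => by
    simp only [mem_filter, mem_univ, true_and, ← hG, compl_adj, ne_comm (b := w)] at hw ⊢
    tauto
  omega

lemma exists_unique_low [Fintype V] [Nonempty V] {G : SimpleGraph V} {n : ℕ}
    (hpair : PairsDominate G n) : ∃ z, ∀ v, v ≠ z → n ≤ 2 * (degIn G univ v + 1) := by
  by_cases h : ∀ v, n ≤ 2 * (degIn G univ v + 1)
  · exact ⟨Classical.arbitrary V, fun v _ => h v⟩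
  · obtain ⟨z, hz⟩ := not_forall.1 h
    refine ⟨z, fun v hv => ?_⟩
    have := miss_add_le_of_degIn hpair (E := ∅) hv (a := max (degIn G univ v) (degIn G univ z))
      (by simp) (by simp)
    by_contra! h2
    simp only [card_empty] at this
    omega

lemma card_low_le [Fintype V] {G : SimpleGraph V} {n : ℕ} (hn : 4516 ≤ n)
    (hV : Fintype.card V = 2 * n - 1) (hpair : PairsDominate G n) :
    #{v | ¬ 57 * n ≤ 100 * degIn G univ v} ≤ 21 := by
  refine Nat.le_of_lt_succ (card_lt_of_johnson _
    (fun v => ({w | ¬ (w = v ∨ G.Adj v w)} : Finset V)) univ (n - 1) ((143 * n - 100) / 100) 22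
    (2 * n - 1) (fun u _ v _ huv => ?_) (fun v hv => ?_) (by rw [card_univ, hV]) ?_)
  · have h1 := hpair u v huv
    have h2 := card_filter_add_card_filter_not (s := (univ : Finset V))
      (fun w => w = u ∨ w = v ∨ G.Adj u w ∨ G.Adj v w)
    have h3 : #(univ ∩ (({w | ¬ (w = u ∨ G.Adj u w)} : Finset V) ∩
        ({w | ¬ (w = v ∨ G.Adj v w)} : Finset V))) ≤
        #{w | ¬ (w = u ∨ w = v ∨ G.Adj u w ∨ G.Adj v w)} := card_le_card fun w hw => by
      simp only [mem_inter, mem_filter, mem_univ, true_and] at hw ⊢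
      tauto
    rw [card_univ] at h2
    omega
  · have h1 := (mem_filter.1 hv).2
    have h2 := card_filter_add_card_filter_not (s := (univ : Finset V))
      (fun w => w = v ∨ G.Adj v w)
    have h3 : #{w | w = v ∨ G.Adj v w} ≤ #(insert v ({w | G.Adj v w} : Finset V)) :=
      card_le_card fun w hw => by
        simp only [mem_insert, mem_filter, mem_univ, true_and] at hw ⊢
        exact hw
    have h4 := card_insert_le v ({w | G.Adj v w} : Finset V)
    rw [card_univ] at h2
    rw [univ_inter]
    unfold degIn at h1
    omega
  · obtain ⟨m, rfl⟩ : ∃ m, n = m + 1 := ⟨n - 1, by omega⟩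
    have h1 : 143 * m ≤ 100 * ((143 * (m + 1) - 100) / 100) + 56 := by omega
    have h2 : 100 * ((143 * (m + 1) - 100) / 100) ≤ 143 * m + 43 := by omega
    generalize (143 * (m + 1) - 100) / 100 = t at h1 h2
    have h3 : 2 * (m + 1) - 1 = 2 * m + 1 := by omega
    rw [h3, Nat.add_sub_cancel]
    obtain ⟨r, rfl⟩ : ∃ r, m = r + 4515 := ⟨m - 4515, by omega⟩
    nlinarith

theorem hasCycleLength_of_pairsDominate [Fintype V] {G : SimpleGraph V} {n : ℕ} (hn : 4516 ≤ n)
    (hne : Even n) (hV : Fintype.card V = 2 * n - 1) (hpair : PairsDominate G n) :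
    HasCycleLength G n := by
  have : Nonempty V := Fintype.card_pos_iff.1 (by omega)
  obtain ⟨z, hz⟩ := exists_unique_low hpair
  have hL := card_low_le hn hV hpair
  by_cases hB : ∃ h, #{v | degIn G {v | 48 ≤ #{w | G.Adj v w ∧ G.Adj h w}} v < 33} ≤ 225
  · obtain ⟨h, hh⟩ := hB
    exact hasCycleLength_of_few_bad hn hV hpair hz hL h hh
  · refine hasCycleLength_of_many_bad hn hne hV hpair hz hL fun h => ?_
    have := not_exists.1 hB h
    omega

lemma not_ramseyProp_of_classes {N n : ℕ} (f : Fin N → Bool) (hf : ∀ b, #{x | f x = b} < n) :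
    ¬ RamseyProp 2 n n N := by
  intro h
  rcases h ((⊤ : SimpleGraph Bool).comap f) with ⟨φ, hφ⟩ | ⟨v, c, hc, hlen⟩
  · refine (hf (!f (φ (Sum.inl 0)))).not_ge ?_
    have hcard : #(univ.image fun j : Fin n => φ (Sum.inr j)) = n := by
      rw [card_image_of_injective univ (f := fun j : Fin n => φ (Sum.inr j))
        (hφ.comp Sum.inr_injective), card_fin]
    refine hcard.symm.trans_le (card_le_card fun x hx => ?_)
    obtain ⟨j, -, rfl⟩ := mem_image.1 hx
    have h1 : f (φ (Sum.inl 0)) ≠ f (φ (Sum.inr j)) :=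
      φ.map_adj (show (completeBipartiteGraph (Fin 2) (Fin n)).Adj (Sum.inl 0) (Sum.inr j) by simp)
    rw [mem_filter]
    refine ⟨mem_univ _, ?_⟩
    revert h1
    cases f (φ (Sum.inl 0)) <;> cases f (φ (Sum.inr j)) <;> simp
  · have hwalk : ∀ {a b : Fin N} (p : ((⊤ : SimpleGraph Bool).comap f)ᶜ.Walk a b),
        ∀ x ∈ p.support, f x = f a := by
      intro a b p
      induction p with
      | nil => simp
      | cons hadj p ih =>
        intro x hx
        rw [Walk.support_cons, List.mem_cons] at hx
        rcases hx with rfl | hx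
        · rfl
        · rw [ih x hx]
          simp only [compl_adj, comap_adj, top_adj, not_not] at hadj
          exact hadj.2.symm
    refine (hf (f v)).not_ge ?_
    have h1 : #c.support.tail.toFinset = n := by
      rw [List.toFinset_card_of_nodup hc.support_nodup, List.length_tail, Walk.length_support,
        hlen, Nat.add_sub_cancel]
    rw [← h1]
    refine card_le_card fun x hx => ?_
    rw [mem_filter]
    exact ⟨mem_univ _, hwalk c x (List.mem_of_mem_tail (List.mem_toFinset.1 hx))⟩

lemma le_of_ramseyProp {N n : ℕ} (hn : 1 ≤ n) (h : RamseyProp 2 n n N) : 2 * n - 1 ≤ N := by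
  by_contra! hN
  refine not_ramseyProp_of_classes (fun x : Fin N => decide (x.1 < n - 1)) (fun b => ?_) h
  refine lt_of_le_of_lt ?_ (Nat.sub_lt hn one_pos)
  cases b
  · have : #(Ico (n - 1) N) ≤ n - 1 := by
      rw [Nat.card_Ico]
      omega
    refine (card_le_card_of_injOn (fun x : Fin N => x.1) (fun x hx => ?_)
      Fin.val_injective.injOn).trans this
    simpa using hx
  · have : #(range (n - 1)) ≤ n - 1 := (card_range _).le
    refine (card_le_card_of_injOn (fun x : Fin N => x.1) (fun x hx => ?_)
      Fin.val_injective.injOn).trans this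
    simpa using hx

end RamseyCycle

theorem stmt_1 (n : ℕ) (hn : 4516 ≤ n) (hne : Even n) :
    IsLeast {N | RamseyProp 2 n n N} (2 * n - 1) := by
  refine ⟨fun Γ => or_iff_not_imp_left.2 fun h => ?_, fun N hN =>
    RamseyCycle.le_of_ramseyProp (by omega) hN⟩
  have hV : Fintype.card (Fin (2 * n - 1)) = 2 * n - 1 := Fintype.card_fin _
  exact RamseyCycle.hasCycleLength_of_pairsDominate hn hne hV
    (RamseyCycle.pairsDominate_compl hV h)
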